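/- arXiv:1101.4553 — 4 statements merged into one kernel-verified Lean document; each statement's English description precedes it below -/
import Mathlib

section
/- Let (n_k)_{k≥0} be a strictly increasing sequence of positive integers such that either n_{k+1}/n_k → ∞ as k → ∞, or n_k divides n_{k+1} for every k ≥ 0 and limsup_{k→∞} n_{k+1}/n_k = +∞. Then there exists a bounded linear operator T on the Hilbert space ℓ²(ℕ, ℂ) such that T has perfectly spanning unimodular eigenvectors and ‖T^{n_k} − I‖ → 0 as k → ∞; in particular (n_k)_{k≥0} is a uniform rigidity sequence for linear dynamical systems. -/
open MeasureTheory Filter Topology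

/-- A bounded operator `T` on a complex Hilbert space has perfectly spanning unimodular
eigenvectors if there is a continuous probability measure `σ` on the unit circle such that
for every Borel subset `B` of the circle of full measure, the closed linear span of the
eigenspaces `ker (T - λ)`, `λ ∈ B`, is the whole space. -/
def PerfectlySpanning {H : Type*} [NormedAddCommGroup H] [InnerProductSpace ℂ H]
    (T : H →L[ℂ] H) : Prop :=
  ∃ σ : Measure ℂ, IsProbabilityMeasure σ ∧ σ {z : ℂ | ‖z‖ = 1}ᶜ = 0 ∧
    (∀ z : ℂ, σ {z} = 0) ∧
    ∀ B : Set ℂ, MeasurableSet B → B ⊆ {z : ℂ | ‖z‖ = 1} → σ B = 1 →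
      (⨆ z ∈ B, Module.End.eigenspace (T : H →ₗ[ℂ] H) z).topologicalClosure = ⊤


lemma exists_small_div (n : ℕ → ℕ) (hmono : StrictMono n) (hpos : ∀ k, 0 < n k)
    (hd : ∀ k, n k ∣ n (k + 1)) (hC : ∀ C : ℝ, ∃ k, C ≤ (n (k + 1) : ℝ) / (n k : ℝ))
    (ε : ℝ) (hε : 0 < ε) :
    ∃ t : ℝ, 0 < t ∧ t < ε ∧ (∀ k, |(n k : ℝ) * t - round ((n k : ℝ) * t)| ≤ ε) ∧
      Tendsto (fun k => |(n k : ℝ) * t - round ((n k : ℝ) * t)|) atTop (𝓝 0) := by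
  obtain ⟨m, hm⟩ := hC (2 / ε)
  have h0 : (0:ℝ) < n m := by exact_mod_cast hpos m
  have h1 : (0:ℝ) < n (m+1) := by exact_mod_cast hpos (m+1)
  have hone : (1:ℝ) ≤ n m := by exact_mod_cast hpos m
  have hm' : (n m : ℝ) * (1 / n (m+1)) ≤ ε / 2 := by
    rw [div_le_div_iff₀ hε h0] at hm
    rw [mul_one_div, div_le_iff₀ h1]; linarith
  have hbig : ∀ k, m + 1 ≤ k → |(n k : ℝ) * (1 / n (m+1)) - round ((n k : ℝ) * (1 / n (m+1)))| = 0 := by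
    intro k hk
    have hdv : n (m+1) ∣ n k := by
      induction k, hk using Nat.le_induction with
      | base => exact dvd_rfl
      | succ k _ ih => exact ih.trans (hd k)
    obtain ⟨c, hc⟩ := hdv
    have : (n k : ℝ) * (1 / n (m+1)) = ((c : ℤ) : ℝ) := by
      rw [hc]; push_cast; field_simp
    rw [this, round_intCast]; simp
  refine ⟨1 / n (m+1), by positivity, ?_, ?_, ?_⟩
  · have : 1 / (n (m+1) : ℝ) ≤ (n m : ℝ) * (1 / n (m+1)) :=
      le_mul_of_one_le_left (by positivity) hone
    linarith
  · intro k
    rcases le_or_gt (m+1) k with hk | hk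
    · rw [hbig k hk]; exact hε.le
    · refine (round_le _ 0).trans ?_
      have : (n k : ℝ) ≤ n m := by exact_mod_cast hmono.monotone (by omega)
      rw [Int.cast_zero, sub_zero, abs_of_nonneg (by positivity)]
      have := mul_le_mul_of_nonneg_right this (by positivity : 0 ≤ 1 / (n (m+1) : ℝ))
      linarith
  · refine tendsto_const_nhds.congr' ?_
    filter_upwards [eventually_ge_atTop (m+1)] with k hk
    exact (hbig k hk).symm

lemma exists_small_ratio (n : ℕ → ℕ) (hmono : StrictMono n) (hpos : ∀ k, 0 < n k)
    (hr : Tendsto (fun k => (n (k + 1) : ℝ) / (n k : ℝ)) atTop atTop)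
    (ε : ℝ) (hε : 0 < ε) :
    ∃ t : ℝ, 0 < t ∧ t < ε ∧ (∀ k, |(n k : ℝ) * t - round ((n k : ℝ) * t)| ≤ ε) ∧
      Tendsto (fun k => |(n k : ℝ) * t - round ((n k : ℝ) * t)|) atTop (𝓝 0) := by
  have hp : ∀ k, (0:ℝ) < n k := fun k => by exact_mod_cast hpos k
  obtain ⟨M, hM⟩ := eventually_atTop.1 (hr.eventually_ge_atTop (max 2 (4 / ε)))
  have h2 : ∀ k, M ≤ k → 2 * (n k : ℝ) ≤ n (k+1) := fun k hk =>
    (le_div_iff₀ (hp k)).1 ((le_max_left _ _).trans (hM k hk))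
  have h4 : ∀ k, M ≤ k → (n k : ℝ) / n (k+1) ≤ ε / 4 := fun k hk => by
    have := (le_max_right _ _).trans (hM k hk)
    rw [div_le_div_iff₀ hε (hp k)] at this
    rw [div_le_div_iff₀ (hp _) (by norm_num)]; linarith
  -- approximations
  let θ : ℕ → ℝ := fun i => Nat.rec (1 / (n (M+1) : ℝ))
    (fun i x => round (x * n (M+1+(i+1))) / (n (M+1+(i+1)) : ℝ)) i
  have hθ0 : θ 0 = 1 / (n (M+1) : ℝ) := rfl
  have hθs : ∀ i, θ (i+1) = round (θ i * n (M+1+(i+1))) / (n (M+1+(i+1)) : ℝ) := fun i => rfl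
  have hzint : ∀ i, ∃ z : ℤ, (n (M+1+i) : ℝ) * θ i = z := by
    intro i
    cases i with
    | zero => exact ⟨1, by rw [hθ0]; have := hp (M+1); simp; field_simp⟩
    | succ i => exact ⟨round (θ i * n (M+1+(i+1))), by rw [hθs]; have := hp (M+1+(i+1)); field_simp⟩
  have hstep : ∀ i, dist (θ i) (θ (i+1)) ≤ 1 / (n (M+1+(i+1)) : ℝ) / 2 := by
    intro i
    rw [hθs, Real.dist_eq]
    have h := hp (M+1+(i+1))
    have e : θ i - round (θ i * n (M+1+(i+1))) / (n (M+1+(i+1)) : ℝ)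
        = (θ i * n (M+1+(i+1)) - round (θ i * n (M+1+(i+1)))) / (n (M+1+(i+1)) : ℝ) := by
      field_simp
    rw [e, abs_div, abs_of_pos h, div_div, div_le_div_iff₀ h (by positivity)]
    have := abs_sub_round (θ i * n (M+1+(i+1)))
    nlinarith
  have hgrow : ∀ i l, (2:ℝ)^l * n (M+1+(i+1)) ≤ n (M+1+(i+l+1)) := by
    intro i l
    induction l with
    | zero => simp
    | succ l ih =>
      have := h2 (M+1+(i+l+1)) (by omega)
      calc (2:ℝ)^(l+1) * n (M+1+(i+1)) = 2 * (2^l * n (M+1+(i+1))) := by ring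
        _ ≤ 2 * n (M+1+(i+l+1)) := by linarith
        _ ≤ _ := this
  have hgeo : ∀ i l, dist (θ (i+l)) (θ (i+l+1)) ≤ 1 / (n (M+1+(i+1)) : ℝ) / 2 / 2 ^ l := by
    intro i l
    refine (hstep (i+l)).trans ?_
    rw [div_right_comm _ (2:ℝ) (2^l), div_le_div_iff_of_pos_right (by norm_num), div_div]
    refine one_div_le_one_div_of_le ?_ ?_
    · have := hp (M+1+(i+1)); positivity
    · rw [mul_comm]; exact hgrow i l
  have hc : CauchySeq θ := cauchySeq_of_le_geometric_two (C := 1 / (n (M+1+(0+1)) : ℝ))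
    (fun l => by simpa using hgeo 0 l)
  obtain ⟨t, ht⟩ := cauchySeq_tendsto_of_complete hc
  have hlim : ∀ i, dist (θ i) t ≤ 1 / (n (M+1+(i+1)) : ℝ) := by
    intro i
    have := dist_le_of_le_geometric_two_of_tendsto₀ (f := fun l => θ (i+l))
      (C := 1 / (n (M+1+(i+1)) : ℝ)) (fun l => by simpa [add_assoc] using hgeo i l)
      (a := t) (by
        have := (tendsto_add_atTop_iff_nat i).2 ht
        simpa [add_comm] using this)
    simpa using this
  have hrat : ∀ i, |(n (M+1+i) : ℝ) * t - round ((n (M+1+i) : ℝ) * t)|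
      ≤ (n (M+1+i) : ℝ) / n (M+1+i+1) := by
    intro i
    obtain ⟨z, hz⟩ := hzint i
    refine (round_le _ z).trans ?_
    rw [← hz, ← mul_sub, abs_mul, abs_of_pos (hp _), abs_sub_comm, ← Real.dist_eq, div_eq_mul_one_div]
    exact mul_le_mul_of_nonneg_left (hlim i) (hp _).le
  have hl0 := hlim 0
  rw [Real.dist_eq, hθ0, abs_le] at hl0
  have hq : 1 / (n (M+1+(0+1)) : ℝ) ≤ 1 / (n (M+1)) / 2 := by
    rw [div_div]
    refine one_div_le_one_div_of_le ?_ ?_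
    · have := hp (M+1); positivity
    · have := h2 (M+1) (by omega); simpa [mul_comm] using this
  have hpos1 : 0 < 1 / (n (M+1) : ℝ) := by have := hp (M+1); positivity
  have htpos : 0 < t := by linarith [hl0.2]
  have htle : t ≤ 2 * (1 / (n (M+1) : ℝ)) := by linarith [hl0.1]
  have hMt : (n M : ℝ) * t ≤ ε / 2 := by
    have h1 := h4 M le_rfl
    have h3 := mul_le_mul_of_nonneg_left htle (hp M).le
    rw [div_eq_mul_one_div] at h1
    linarith
  refine ⟨t, htpos, ?_, ?_, ?_⟩
  · have : (1:ℝ) ≤ n M := by exact_mod_cast hpos M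
    nlinarith
  · intro k
    rcases le_or_gt (M+1) k with hk | hk
    · obtain ⟨i, rfl⟩ := Nat.exists_eq_add_of_le hk
      have := h4 (M+1+i) (by omega)
      linarith [hrat i]
    · refine (round_le _ 0).trans ?_
      have : (n k : ℝ) ≤ n M := by exact_mod_cast hmono.monotone (by omega)
      have hk0 := hp k
      rw [Int.cast_zero, sub_zero, abs_of_nonneg (by positivity)]
      have := mul_le_mul_of_nonneg_right this htpos.le
      linarith
  · have hz : Tendsto (fun k => (n k : ℝ) / (n (k + 1) : ℝ)) atTop (𝓝 0) := by
      refine hr.inv_tendsto_atTop.congr fun k => ?_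
      simp
    refine squeeze_zero' (Eventually.of_forall fun k => abs_nonneg _) ?_ hz
    filter_upwards [eventually_ge_atTop (M+1)] with k hk
    obtain ⟨i, rfl⟩ := Nat.exists_eq_add_of_le hk
    exact hrat i

lemma exists_seq (n : ℕ → ℕ)
    (hE : ∀ ε : ℝ, 0 < ε → ∃ t : ℝ, 0 < t ∧ t < ε ∧
      (∀ k, |(n k : ℝ) * t - round ((n k : ℝ) * t)| ≤ ε) ∧
      Tendsto (fun k => |(n k : ℝ) * t - round ((n k : ℝ) * t)|) atTop (𝓝 0)) :
    ∃ t : ℕ → ℝ, (∀ j, 0 < t j) ∧ (∀ j, t (j+1) ≤ t j / 4) ∧ (∀ j, t j ≤ (1/4)^(j+1)) ∧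
      (∀ j k, |(n k : ℝ) * t j - round ((n k : ℝ) * t j)| ≤ (1/4)^(j+1)) ∧
      ∀ j, Tendsto (fun k => |(n k : ℝ) * t j - round ((n k : ℝ) * t j)|) atTop (𝓝 0) := by
  choose g hg using hE
  let s : ℕ → {x : ℝ // 0 < x} := fun j => Nat.rec ⟨1/4, by norm_num⟩
    (fun _ x => ⟨g x.1 x.2 / 4, by have := (hg x.1 x.2).1; positivity⟩) j
  have hs : ∀ j, (s (j+1)).1 = g (s j).1 (s j).2 / 4 := fun j => rfl
  have hs4 : ∀ j, (s j).1 ≤ (1/4)^(j+1) := by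
    intro j
    induction j with
    | zero => simp [s]
    | succ j ih =>
      rw [hs, pow_succ]
      have := (hg (s j).1 (s j).2).2.1
      linarith
  refine ⟨fun j => g (s j).1 (s j).2, fun j => (hg _ _).1, fun j => ?_, fun j => ?_, fun j k => ?_,
    fun j => (hg _ _).2.2.2⟩
  · have := (hg (s (j+1)).1 (s (j+1)).2).2.1
    exact this.le.trans (hs j).le
  · exact (hg _ _).2.1.le.trans (hs4 j)
  · exact ((hg _ _).2.2.1 k).trans (hs4 j)

section
variable {A : Type*} [NormedRing A] [NormedAlgebra ℂ A] [CompleteSpace A]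

lemma exp_smul_idem (Y : A) (hY : Y * Y = Y) (z : ℂ) :
    NormedSpace.exp (z • Y) = Complex.exp z • Y + (1 - Y) := by
  have h1 := NormedSpace.exp_series_hasSum_exp' (𝕂 := ℂ) (z • Y)
  have h2 := (NormedSpace.exp_series_hasSum_exp' (𝕂 := ℂ) z).smul_const Y
  have h3 := h2.add (hasSum_ite_eq (0:ℕ) (1 - Y))
  rw [Complex.exp_eq_exp_ℂ]
  refine h1.unique (h3.congr_fun ?_)
  intro k
  have hp : ∀ k : ℕ, Y ^ (k+1) = Y := by
    intro k
    induction k with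
    | zero => simp
    | succ k ih => rw [pow_succ, ih, hY]
  cases k with
  | zero => simp
  | succ k => simp [smul_pow, hp, smul_smul]

lemma summable_smul_of_bound (Y : ℕ → A) (hn : ∀ j, ‖Y j‖ ≤ 2 * 2 ^ j)
    (c : ℕ → ℂ) (K : ℝ) (hc : ∀ j, ‖c j‖ ≤ K * (1/4)^(j+1)) :
    Summable (fun j => c j • Y j) := by
  have hs : Summable (fun j : ℕ => K * (1/2) * (1/2:ℝ)^j) := summable_geometric_two.mul_left _
  refine Summable.of_norm_bounded hs fun j => ?_
  rw [norm_smul]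
  calc ‖c j‖ * ‖Y j‖ ≤ (K * (1/4)^(j+1)) * (2 * 2 ^ j) :=
        mul_le_mul (hc j) (hn j) (norm_nonneg _) ((norm_nonneg _).trans (hc j))
    _ = K * (1/2) * ((1/4) * 2) ^ j := by rw [mul_pow]; ring
    _ = _ := by norm_num

lemma exp_int_eq_one (Y : ℕ → A) (hY : ∀ j, Y j * Y j = Y j) (hcomm : ∀ i j, Commute (Y i) (Y j))
    (m : ℕ → ℤ)
    (hs : Summable (fun j => (2 * Real.pi * Complex.I * m j : ℂ) • Y j)) :
    NormedSpace.exp (∑' j, (2 * Real.pi * Complex.I * m j : ℂ) • Y j) = 1 := by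
  let _ : NormedAlgebra ℚ A := NormedAlgebra.restrictScalars ℚ ℂ A
  have hfin : ∀ N, NormedSpace.exp (∑ j ∈ Finset.range N, (2 * Real.pi * Complex.I * m j : ℂ) • Y j)
      = 1 := by
    intro N
    induction N with
    | zero => simp
    | succ N ih =>
      rw [Finset.sum_range_succ, NormedSpace.exp_add_of_commute, ih, exp_smul_idem _ (hY N)]
      · have : Complex.exp (2 * Real.pi * Complex.I * m N) = 1 := by
          rw [mul_comm]; exact Complex.exp_int_mul_two_pi_mul_I _
        rw [this]; simp
      · refine Commute.sum_left _ _ _ fun i _ => ?_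
        exact ((hcomm i N).smul_left _).smul_right _
  have h1 := (hs.hasSum.tendsto_sum_nat).exp
  simp only [hfin] at h1
  exact (tendsto_nhds_unique h1 tendsto_const_nhds)

lemma tendsto_pow (Y : ℕ → A) (hY : ∀ j, Y j * Y j = Y j) (hcomm : ∀ i j, Commute (Y i) (Y j))
    (hn : ∀ j, ‖Y j‖ ≤ 2 * 2 ^ j) (n : ℕ → ℕ) (t : ℕ → ℝ) (htpos : ∀ j, 0 < t j)
    (ht : ∀ j, t j ≤ (1/4)^(j+1))
    (hr : ∀ j k, |(n k : ℝ) * t j - round ((n k : ℝ) * t j)| ≤ (1/4)^(j+1))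
    (hr0 : ∀ j, Tendsto (fun k => |(n k : ℝ) * t j - round ((n k : ℝ) * t j)|) atTop (𝓝 0)) :
    Tendsto (fun k => ‖(NormedSpace.exp (∑' j, (2 * Real.pi * Complex.I * t j : ℂ) • Y j)) ^ n k - 1‖)
      atTop (𝓝 0) := by
  let _ : NormedAlgebra ℚ A := NormedAlgebra.restrictScalars ℚ ℂ A
  have hnorm : ∀ x : ℝ, ‖(2 * Real.pi * Complex.I * x : ℂ)‖ = 2 * Real.pi * |x| := by
    intro x
    simp [abs_of_pos Real.pi_pos]
  have hpi : (0:ℝ) ≤ 2 * Real.pi := by positivity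
  have hst : Summable (fun j => (2 * Real.pi * Complex.I * t j : ℂ) • Y j) := by
    refine summable_smul_of_bound Y hn _ (2 * Real.pi) fun j => ?_
    rw [hnorm, abs_of_pos (htpos j)]
    exact mul_le_mul_of_nonneg_left (ht j) hpi
  let r : ℕ → ℕ → ℝ := fun k j => (n k : ℝ) * t j - round ((n k : ℝ) * t j)
  have hsr : ∀ k, Summable (fun j => (2 * Real.pi * Complex.I * r k j : ℂ) • Y j) := by
    intro k
    refine summable_smul_of_bound Y hn _ (2 * Real.pi) fun j => ?_
    rw [hnorm]
    exact mul_le_mul_of_nonneg_left (hr j k) hpi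
  have hdec : ∀ k j, (2 * Real.pi * Complex.I * (round ((n k : ℝ) * t j) : ℤ) : ℂ) • Y j
      = (n k : ℂ) • ((2 * Real.pi * Complex.I * t j : ℂ) • Y j)
        - (2 * Real.pi * Complex.I * r k j : ℂ) • Y j := by
    intro k j
    rw [smul_smul, ← sub_smul]
    congr 1
    simp only [r]; push_cast; ring
  have hsm : ∀ k, Summable (fun j =>
      (2 * Real.pi * Complex.I * (round ((n k : ℝ) * t j) : ℤ) : ℂ) • Y j) := by
    intro k
    simp only [hdec]
    exact (hst.const_smul _).sub (hsr k)
  have key : ∀ k, (NormedSpace.exp (∑' j, (2 * Real.pi * Complex.I * t j : ℂ) • Y j)) ^ n k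
      = NormedSpace.exp (∑' j, (2 * Real.pi * Complex.I * r k j : ℂ) • Y j) := by
    intro k
    have e1 : n k • (∑' j, (2 * Real.pi * Complex.I * t j : ℂ) • Y j)
        = (∑' j, (2 * Real.pi * Complex.I * (round ((n k : ℝ) * t j) : ℤ) : ℂ) • Y j)
          + ∑' j, (2 * Real.pi * Complex.I * r k j : ℂ) • Y j := by
      rw [← (hsm k).tsum_add (hsr k)]
      simp only [hdec, sub_add_cancel]
      rw [hst.tsum_const_smul, Nat.cast_smul_eq_nsmul]
    rw [← NormedSpace.exp_nsmul, e1, NormedSpace.exp_add_of_commute,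
      exp_int_eq_one Y hY hcomm _ (hsm k), one_mul]
    refine Commute.tsum_left _ fun i => Commute.tsum_right _ fun j => ?_
    exact ((hcomm i j).smul_left _).smul_right _
  have hlim : Tendsto (fun k => ∑' j, (2 * Real.pi * Complex.I * r k j : ℂ) • Y j) atTop
      (𝓝 (∑' _ : ℕ, (0 : A))) := by
    have hs : Summable (fun j : ℕ => (2 * Real.pi) * (1/2) * (1/2:ℝ)^j) :=
      summable_geometric_two.mul_left _
    refine tendsto_tsum_of_dominated_convergence hs ?_ ?_
    · intro j
      rw [tendsto_zero_iff_norm_tendsto_zero]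
      simp only [norm_smul, hnorm]
      have := ((hr0 j).const_mul (2 * Real.pi)).mul_const ‖Y j‖
      simpa [r] using this
    · refine Eventually.of_forall fun k j => ?_
      rw [norm_smul, hnorm]
      calc (2 * Real.pi * |r k j|) * ‖Y j‖ ≤ (2 * Real.pi * (1/4)^(j+1)) * (2 * 2 ^ j) :=
            mul_le_mul (mul_le_mul_of_nonneg_left (hr j k) hpi) (hn j) (norm_nonneg _)
              (by positivity)
        _ = (2 * Real.pi) * (1/2) * ((1/4) * 2) ^ j := by rw [mul_pow]; ring
        _ = _ := by norm_num
  have h1 := hlim.exp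
  rw [tsum_zero, NormedSpace.exp_zero] at h1
  simp only [key]
  simpa using (h1.sub_const 1).norm
end

lemma exp_eigen {H : Type*} [NormedAddCommGroup H] [NormedSpace ℂ H] [CompleteSpace H]
    (D : H →L[ℂ] H) (v : H) (z : ℂ) (h : D v = z • v) :
    NormedSpace.exp D v = Complex.exp z • v := by
  have h1 := NormedSpace.exp_series_hasSum_exp' (𝕂 := ℂ) D
  have h1' := h1.mapL (ContinuousLinearMap.apply ℂ H v)
  have h2 := (NormedSpace.exp_series_hasSum_exp' (𝕂 := ℂ) z).smul_const v
  rw [Complex.exp_eq_exp_ℂ]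
  refine h1'.unique (h2.congr_fun ?_)
  intro k
  have hp : ∀ k : ℕ, (D ^ k) v = z ^ k • v := by
    intro k
    induction k with
    | zero => simp
    | succ k ih => rw [pow_succ', mul_apply_eq_comp, ih, map_smul, h, smul_smul, pow_succ]
  simp [hp, smul_smul]

lemma exists_op (c : ℕ → ℂ) (φ : ℕ → ℕ) (τ : ℕ ≃ ℕ) (C : ℝ) (hC : 0 ≤ C) (hc : ∀ a, ‖c a‖ ≤ C)
    (hφ : ∀ a, φ a = a ∨ φ a = τ a) :
    ∃ Y : (lp (fun _ : ℕ => ℂ) 2) →L[ℂ] (lp (fun _ : ℕ => ℂ) 2), ‖Y‖ ≤ 2 * C ∧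
      ∀ v a, Y v a = c a * v (φ a) := by
  have h2 : (0:ℝ) < (2 : ENNReal).toReal := by norm_num
  have hb : ∀ (v : lp (fun _ : ℕ => ℂ) 2) a, ‖c a * v (φ a)‖ ^ (2:ℝ) ≤
      C ^ 2 * (‖v a‖ ^ (2:ℝ) + ‖v (τ a)‖ ^ (2:ℝ)) := by
    intro v a
    simp only [Real.rpow_two]
    rw [norm_mul, mul_pow]
    refine mul_le_mul (pow_le_pow_left₀ (norm_nonneg _) (hc a) 2) ?_ (by positivity) (by positivity)
    rcases hφ a with h | h <;> rw [h]
    · have := sq_nonneg ‖v (τ a)‖; linarith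
    · have := sq_nonneg ‖v a‖; linarith
  have hsum : ∀ v : lp (fun _ : ℕ => ℂ) 2, HasSum (fun a => C ^ 2 * (‖v a‖ ^ (2:ℝ) + ‖v (τ a)‖ ^ (2:ℝ)))
      (C ^ 2 * (‖v‖ ^ (2:ℝ) + ‖v‖ ^ (2:ℝ))) := by
    intro v
    have h := lp.hasSum_norm h2 v
    simp only [ENNReal.toReal_ofNat] at h
    exact (h.add ((Equiv.hasSum_iff τ).2 h)).mul_left _
  have hmem : ∀ v : lp (fun _ : ℕ => ℂ) 2, Memℓp (fun a => c a * v (φ a)) 2 := by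
    intro v
    refine memℓp_gen ?_
    simp only [ENNReal.toReal_ofNat]
    exact Summable.of_nonneg_of_le (fun a => by positivity) (hb v) (hsum v).summable
  let L : (lp (fun _ : ℕ => ℂ) 2) →ₗ[ℂ] (lp (fun _ : ℕ => ℂ) 2) :=
    { toFun := fun v => ⟨fun a => c a * v (φ a), hmem v⟩
      map_add' := fun v w => by
        ext a
        exact mul_add _ _ _
      map_smul' := fun z v => by
        ext a
        simp [mul_left_comm] }
  refine ⟨L.mkContinuous (2 * C) fun v => ?_, LinearMap.mkContinuous_norm_le _ (by positivity) _,
    fun v a => rfl⟩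
  refine lp.norm_le_of_tsum_le h2 (by positivity) ?_
  simp only [ENNReal.toReal_ofNat]
  have hs := Summable.of_nonneg_of_le (fun a => by positivity) (hb v) (hsum v).summable
  calc ∑' a, ‖c a * v (φ a)‖ ^ (2:ℝ) ≤ C ^ 2 * (‖v‖ ^ (2:ℝ) + ‖v‖ ^ (2:ℝ)) :=
        hasSum_le (hb v) hs.hasSum (hsum v)
    _ ≤ (2 * C * ‖v‖) ^ (2:ℝ) := by
      simp only [Real.rpow_two]
      nlinarith [sq_nonneg (C * ‖v‖)]

/-- indicator of a bit -/
noncomputable def bt (b : Bool) : ℝ := if b then 1 else 0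

lemma bt_nonneg (b : Bool) : 0 ≤ bt b := by unfold bt; split_ifs <;> norm_num
lemma bt_le (b : Bool) : bt b ≤ 1 := by unfold bt; split_ifs <;> norm_num

lemma tail_bound (t : ℕ → ℝ) (ht : ∀ j, t (j+1) ≤ t j / 4) (j i : ℕ) :
    t (i + j) ≤ t j * (1/4)^i := by
  induction i with
  | zero => simp
  | succ i ih =>
    have := ht (i + j)
    rw [show i + 1 + j = i + j + 1 by ring, pow_succ]
    linarith

lemma hasSum_quarter (c : ℝ) : HasSum (fun i : ℕ => c * (1/4)^i) (c * (4/3)) := by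
  have := (hasSum_geometric_of_lt_one (r := (1/4:ℝ)) (by norm_num) (by norm_num)).mul_left c
  have e : (1 - 1/4 : ℝ)⁻¹ = 4/3 := by norm_num
  rwa [e] at this

lemma summable_t (t : ℕ → ℝ) (hpos : ∀ j, 0 < t j) (ht : ∀ j, t (j+1) ≤ t j / 4) : Summable t :=
  Summable.of_nonneg_of_le (fun j => (hpos j).le) (fun j => by simpa using tail_bound t ht 0 j)
    (hasSum_quarter (t 0)).summable

lemma summable_bt (t : ℕ → ℝ) (hpos : ∀ j, 0 < t j) (ht : ∀ j, t (j+1) ≤ t j / 4) (x : ℕ → Bool) :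
    Summable (fun j => t j * bt (x j)) :=
  Summable.of_nonneg_of_le (fun j => mul_nonneg (hpos j).le (bt_nonneg _))
    (fun j => mul_le_of_le_one_right (hpos j).le (bt_le _)) (summable_t t hpos ht)

lemma sum_injective (t : ℕ → ℝ) (hpos : ∀ j, 0 < t j) (ht : ∀ j, t (j+1) ≤ t j / 4) :
    Function.Injective (fun x : ℕ → Bool => ∑' j, t j * bt (x j)) := by
  intro x y hxy
  by_contra hne
  have hex : ∃ j, x j ≠ y j := by
    by_contra! h
    exact hne (funext h)
  classical
  let j := Nat.find hex
  have hj : x j ≠ y j := Nat.find_spec hex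
  have hlt : ∀ i < j, x i = y i := fun i hi => by
    have := Nat.find_min hex hi
    simpa using this
  have hs := (summable_bt t hpos ht x).sub (summable_bt t hpos ht y)
  have h0 : ∑' i, (t i * bt (x i) - t i * bt (y i)) = 0 := by
    rw [(summable_bt t hpos ht x).tsum_sub (summable_bt t hpos ht y)]
    exact sub_eq_zero.2 hxy
  rw [← hs.sum_add_tsum_nat_add (j+1), Finset.sum_range_succ, Finset.sum_eq_zero, zero_add] at h0
  swap
  · intro i hi
    rw [hlt i (Finset.mem_range.1 hi), sub_self]
  have habs : |t j * bt (x j) - t j * bt (y j)| = t j := by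
    have := hpos j
    rcases hx : x j <;> rcases hy : y j <;> simp_all [bt, abs_of_pos]
  have htail : ‖∑' i, (t (i + (j+1)) * bt (x (i + (j+1))) - t (i + (j+1)) * bt (y (i + (j+1))))‖
      ≤ t (j+1) * (4/3) := by
    refine tsum_of_norm_bounded (hasSum_quarter _) fun i => ?_
    refine le_trans ?_ (tail_bound t ht (j+1) i)
    rw [← mul_sub, norm_mul, Real.norm_of_nonneg (hpos _).le]
    refine mul_le_of_le_one_right (hpos _).le ?_
    rw [Real.norm_eq_abs, abs_le]
    constructor <;> linarith [bt_nonneg (x (i + (j+1))), bt_nonneg (y (i + (j+1))),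
      bt_le (x (i + (j+1))), bt_le (y (i + (j+1)))]
  rw [add_eq_zero_iff_eq_neg] at h0
  rw [h0, abs_neg, ← Real.norm_eq_abs] at habs
  have := ht j
  have := hpos j
  linarith

lemma sum_bounds (t : ℕ → ℝ) (hpos : ∀ j, 0 < t j) (ht : ∀ j, t (j+1) ≤ t j / 4)
    (ht0 : t 0 ≤ 1/4) (x : ℕ → Bool) :
    0 ≤ ∑' j, t j * bt (x j) ∧ ∑' j, t j * bt (x j) ≤ 1/3 := by
  refine ⟨tsum_nonneg fun j => mul_nonneg (hpos j).le (bt_nonneg _), ?_⟩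
  have : ∑' j, t j * bt (x j) ≤ t 0 * (4/3) :=
    hasSum_le (fun j => (mul_le_of_le_one_right (hpos j).le (bt_le _)).trans
      (by simpa using tail_bound t ht 0 j)) (summable_bt t hpos ht x).hasSum (hasSum_quarter (t 0))
  linarith

/-- the parametrisation of eigenvalues -/
noncomputable def lam (t : ℕ → ℝ) (x : ℕ → Bool) : ℂ :=
  Complex.exp (2 * Real.pi * Complex.I * ((∑' j, t j * bt (x j) : ℝ) : ℂ))

lemma lam_injective (t : ℕ → ℝ) (hpos : ∀ j, 0 < t j) (ht : ∀ j, t (j+1) ≤ t j / 4)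
    (ht0 : t 0 ≤ 1/4) : Function.Injective (lam t) := by
  intro x y h
  apply sum_injective t hpos ht
  obtain ⟨m, hm⟩ := Complex.exp_eq_exp_iff_exists_int.1 h
  have hpi : (2 * Real.pi * Complex.I : ℂ) ≠ 0 := Complex.two_pi_I_ne_zero
  have h1 : ((∑' j, t j * bt (x j) : ℝ) : ℂ) = ((∑' j, t j * bt (y j) : ℝ) : ℂ) + m := by
    apply mul_left_cancel₀ hpi
    rw [hm]; ring
  have h2 : (∑' j, t j * bt (x j) : ℝ) = (∑' j, t j * bt (y j) : ℝ) + m := by exact_mod_cast h1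
  have hx := sum_bounds t hpos ht ht0 x
  have hy := sum_bounds t hpos ht ht0 y
  have hm1 : (m : ℝ) < 1 := by linarith
  have hm2 : (-1 : ℝ) < m := by linarith
  have : m = 0 := by
    have a : m < 1 := by exact_mod_cast hm1
    have b : -1 < m := by exact_mod_cast hm2
    omega
  simp only [this, Int.cast_zero, add_zero] at h2
  exact h2

lemma continuous_bt : Continuous bt := continuous_of_discreteTopology

lemma lam_continuous (t : ℕ → ℝ) (hpos : ∀ j, 0 < t j) (ht : ∀ j, t (j+1) ≤ t j / 4) :
    Continuous (lam t) := by
  have : Continuous (fun x : ℕ → Bool => ∑' j, t j * bt (x j)) := by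
    refine continuous_tsum (fun j => ?_) (summable_t t hpos ht) fun j x => ?_
    · exact continuous_const.mul (continuous_bt.comp (continuous_apply j))
    · rw [norm_mul, Real.norm_of_nonneg (hpos _).le, Real.norm_of_nonneg (bt_nonneg _)]
      exact mul_le_of_le_one_right (hpos j).le (bt_le _)
  unfold lam
  fun_prop

lemma norm_lam (t : ℕ → ℝ) (x : ℕ → Bool) : ‖lam t x‖ = 1 := by
  unfold lam
  rw [Complex.norm_exp]
  simp

/-- coin tossing measure -/
noncomputable def coin : Measure (ℕ → Bool) :=
  Measure.infinitePi fun _ => (PMF.uniformOfFintype Bool).toMeasure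

instance : IsProbabilityMeasure coin := by unfold coin; infer_instance

lemma coin_singleton (x : ℕ → Bool) : coin {x} = 0 := by
  have h : ∀ N : ℕ, coin {x} ≤ (2⁻¹ : ENNReal) ^ N := by
    intro N
    have : ({x} : Set (ℕ → Bool)) ⊆ Set.pi (Finset.range N : Set ℕ) (fun i => {x i}) := by
      rintro y rfl; simp
    refine (measure_mono this).trans ?_
    rw [coin, Measure.infinitePi_pi _ (by measurability)]
    simp
  have h2 := ENNReal.tendsto_pow_atTop_nhds_zero_of_lt_one (r := 2⁻¹) (by simp)
  exact le_antisymm (ge_of_tendsto' h2 h) bot_le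

lemma coin_open (U : Set (ℕ → Bool)) (hU : IsOpen U) (hne : U.Nonempty) : coin U ≠ 0 := by
  obtain ⟨x, hx⟩ := hne
  obtain ⟨I, u, hu, hsub⟩ := isOpen_pi_iff.1 hU x hx
  intro h0
  have h1 : coin (Set.pi (I : Set ℕ) u) = 0 := measure_mono_null hsub h0
  rw [coin, Measure.infinitePi_pi _ (fun i _ => (hu i ‹_›).1.measurableSet), Finset.prod_eq_zero_iff] at h1
  obtain ⟨i, hi, h2⟩ := h1
  have h3 := measure_mono_null (Set.singleton_subset_iff.2 (hu i hi).2) h2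
  simp at h3

lemma dense_of_full (s : Set (ℕ → Bool)) (hs : MeasurableSet s) (h : coin s = 1) : Dense s := by
  rw [dense_iff_inter_open]
  intro U hU hne
  by_contra hc
  have hsub : U ⊆ sᶜ := fun x hx hxs => hc ⟨x, hx, hxs⟩
  exact coin_open U hU hne (measure_mono_null hsub ((prob_compl_eq_zero_iff hs).2 h))

/-- enumeration of finite subsets -/
def fenum : ℕ ≃ Finset ℕ := (Denumerable.eqv (Finset ℕ)).symm

/-- coordinates of eigenvectors -/
noncomputable def vcoef (x : ℕ → Bool) (a : ℕ) : ℝ := ∏ i ∈ fenum a, bt (x i) * (1/2)^i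

/-- dominating coordinates -/
noncomputable def bcoef (a : ℕ) : ℝ := ∏ i ∈ fenum a, (1/2 : ℝ)^i

lemma vcoef_nonneg (x : ℕ → Bool) (a : ℕ) : 0 ≤ vcoef x a :=
  Finset.prod_nonneg fun i _ => mul_nonneg (bt_nonneg _) (by positivity)

lemma vcoef_le (x : ℕ → Bool) (a : ℕ) : vcoef x a ≤ bcoef a :=
  Finset.prod_le_prod (fun i _ => mul_nonneg (bt_nonneg _) (by positivity))
    fun i _ => mul_le_of_le_one_left (by positivity) (bt_le _)

lemma summable_bcoef : Summable (fun a => bcoef a ^ 2) := by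
  have h : Summable (fun s : Finset ℕ => ∏ i ∈ s, (1/4 : ℝ)^i) :=
    summable_finsetProd_of_summable_nonneg (fun i => by positivity)
      (summable_geometric_of_lt_one (by norm_num) (by norm_num))
  refine ((Equiv.summable_iff fenum).2 h).congr fun a => ?_
  simp only [bcoef, Function.comp, ← Finset.prod_pow]
  refine Finset.prod_congr rfl fun i _ => ?_
  rw [← pow_mul, mul_comm, pow_mul]; norm_num

lemma memv (x : ℕ → Bool) : Memℓp (fun a => (vcoef x a : ℂ)) 2 := by
  refine memℓp_gen ?_
  simp only [ENNReal.toReal_ofNat, Real.rpow_two]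
  refine Summable.of_nonneg_of_le (fun a => by positivity) (fun a => ?_) summable_bcoef
  rw [Complex.norm_real, Real.norm_of_nonneg (vcoef_nonneg x a)]
  exact pow_le_pow_left₀ (vcoef_nonneg x a) (vcoef_le x a) 2

/-- eigenvectors -/
noncomputable def vvec (x : ℕ → Bool) : lp (fun _ : ℕ => ℂ) 2 := ⟨_, memv x⟩

lemma vvec_apply (x : ℕ → Bool) (a : ℕ) : vvec x a = (vcoef x a : ℂ) := rfl

lemma continuous_vcoef (a : ℕ) : Continuous (fun x => vcoef x a) := by
  unfold vcoef
  refine continuous_finsetProd _ fun i _ => ?_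
  exact (continuous_bt.comp (continuous_apply i)).mul continuous_const

lemma inner_vvec (x : ℕ → Bool) (f : lp (fun _ : ℕ => ℂ) 2) :
    inner ℂ (vvec x) f = ∑' a, (vcoef x a : ℂ) * f a := by
  rw [lp.inner_eq_tsum]
  refine tsum_congr fun a => ?_
  rw [vvec_apply]
  simp [mul_comm]

lemma continuous_inner_vvec (f : lp (fun _ : ℕ => ℂ) 2) :
    Continuous (fun x => inner ℂ (vvec x) f) := by
  simp only [inner_vvec]
  have hf : Summable (fun a => ‖f a‖ ^ 2) := by
    have := (lp.hasSum_norm (by norm_num : (0:ℝ) < (2 : ENNReal).toReal) f).summable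
    simpa using this
  refine continuous_tsum (u := fun a => bcoef a ^ 2 + ‖f a‖ ^ 2) (fun a => ?_)
    (summable_bcoef.add hf) fun a x => ?_
  · exact (Complex.continuous_ofReal.comp (continuous_vcoef a)).mul continuous_const
  · rw [norm_mul, Complex.norm_real, Real.norm_of_nonneg (vcoef_nonneg x a)]
    have h1 := mul_le_mul_of_nonneg_right (vcoef_le x a) (norm_nonneg (f a))
    nlinarith [sq_nonneg (bcoef a - ‖f a‖), sq_nonneg (bcoef a), sq_nonneg ‖f a‖]

lemma eq_zero_of_inner (f : lp (fun _ : ℕ => ℂ) 2) (h : ∀ x, inner ℂ (vvec x) f = 0) : f = 0 := by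
  have key : ∀ G : Finset ℕ, f (fenum.symm G) = 0 := by
    intro G
    induction G using Finset.strongInduction with
    | H G ih =>
      have hG := h (fun i => decide (i ∈ G))
      rw [inner_vvec, tsum_eq_single (fenum.symm G)] at hG
      · have hv : vcoef (fun i => decide (i ∈ G)) (fenum.symm G) ≠ 0 := by
          unfold vcoef
          rw [Equiv.apply_symm_apply, Finset.prod_ne_zero_iff]
          intro i hi
          simp [bt, hi]
        rcases mul_eq_zero.1 hG with h1 | h1
        · exact absurd (by exact_mod_cast h1) hv
        · exact h1
      · intro a ha
        by_cases hs : fenum a ⊆ G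
        · have hss : fenum a ⊂ G := by
            refine hs.ssubset_of_ne fun he => ha ?_
            rw [← he, Equiv.symm_apply_apply]
          have := ih _ hss
          rw [Equiv.symm_apply_apply] at this
          rw [this, mul_zero]
        · obtain ⟨i, hi, hiG⟩ := Finset.not_subset.1 hs
          have : vcoef (fun i => decide (i ∈ G)) a = 0 :=
            Finset.prod_eq_zero hi (by simp [bt, hiG])
          rw [this]; simp
  ext a
  have := key (fenum a)
  rw [Equiv.symm_apply_apply] at this
  simpa using this

/-- toggling an element -/
def toggle (j : ℕ) : ℕ ≃ ℕ :=
  (fenum.trans (Function.Involutive.toPerm (fun F : Finset ℕ => symmDiff F {j})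
    (fun F => by simp))).trans fenum.symm

/-- weights -/
noncomputable def wt (j a : ℕ) : ℂ := if j ∈ fenum a then 1 else 2 ^ j

/-- index map -/
def ins (j a : ℕ) : ℕ := fenum.symm (insert j (fenum a))

lemma fenum_ins (j a : ℕ) : fenum (ins j a) = insert j (fenum a) := by simp [ins]

lemma exists_Y (j : ℕ) :
    ∃ Y : (lp (fun _ : ℕ => ℂ) 2) →L[ℂ] (lp (fun _ : ℕ => ℂ) 2), ‖Y‖ ≤ 2 * 2 ^ j ∧
      ∀ v a, Y v a = wt j a * v (ins j a) := by
  refine exists_op (wt j) (ins j) (toggle j) (2 ^ j) (by positivity) (fun a => ?_) fun a => ?_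
  · unfold wt
    split_ifs
    · simpa using one_le_pow₀ (by norm_num : (1:ℝ) ≤ 2)
    · simp
  · by_cases hj : j ∈ fenum a
    · left
      rw [ins, Finset.insert_eq_self.2 hj, Equiv.symm_apply_apply]
    · right
      simp only [ins, toggle, Equiv.trans_apply]
      congr 1
      change insert j (fenum a) = symmDiff (fenum a) {j}
      ext i
      simp only [Finset.mem_insert, Finset.mem_symmDiff,
        Finset.mem_singleton]
      by_cases hij : i = j
      · subst hij; simp [hj]
      · simp [hij]

lemma wt_mul_vcoef (x : ℕ → Bool) (j a : ℕ) :
    wt j a * (vcoef x (ins j a) : ℂ) = (bt (x j) : ℂ) * vcoef x a := by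
  unfold vcoef wt
  rw [fenum_ins]
  by_cases hj : j ∈ fenum a
  · rw [if_pos hj, Finset.insert_eq_self.2 hj, one_mul]
    rcases hx : x j with _ | _
    · rw [Finset.prod_eq_zero hj (by simp [bt, hx])]; simp
    · simp [bt]
  · rw [if_neg hj, Finset.prod_insert hj]
    push_cast
    have : (2:ℂ)^j * (1/2)^j = 1 := by rw [← mul_pow]; norm_num
    linear_combination (bt (x j) : ℂ) * (∏ i ∈ fenum a, (bt (x i) : ℂ) * (1/2)^i) * this

lemma main_of_seq (n : ℕ → ℕ) (t : ℕ → ℝ) (hpos : ∀ j, 0 < t j) (ht : ∀ j, t (j+1) ≤ t j / 4)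
    (ht4 : ∀ j, t j ≤ (1/4)^(j+1))
    (hr : ∀ j k, |(n k : ℝ) * t j - round ((n k : ℝ) * t j)| ≤ (1/4)^(j+1))
    (hr0 : ∀ j, Tendsto (fun k => |(n k : ℝ) * t j - round ((n k : ℝ) * t j)|) atTop (𝓝 0)) :
    ∃ T : (lp (fun _ : ℕ => ℂ) 2) →L[ℂ] (lp (fun _ : ℕ => ℂ) 2),
      PerfectlySpanning T ∧ Tendsto (fun k => ‖T ^ (n k) - 1‖) atTop (𝓝 0) := by
  choose Y hYn hY using exists_Y
  have hidem : ∀ j, Y j * Y j = Y j := by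
    intro j
    ext v a
    rw [mul_apply_eq_comp, hY, hY, hY]
    have e : ins j (ins j a) = ins j a := by
      apply fenum.injective
      simp [fenum_ins]
    have e2 : wt j (ins j a) = 1 := by simp [wt, fenum_ins]
    rw [e, e2, one_mul]
  have hcomm : ∀ i j, Commute (Y i) (Y j) := by
    intro i j
    by_cases hij : i = j
    · subst hij; exact Commute.refl _
    have hji : j ≠ i := Ne.symm hij
    change Y i * Y j = Y j * Y i
    ext v a
    rw [mul_apply_eq_comp, mul_apply_eq_comp, hY, hY, hY, hY]
    have e : ins j (ins i a) = ins i (ins j a) := by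
      apply fenum.injective
      simp [fenum_ins, Finset.insert_comm]
    have e1 : wt j (ins i a) = wt j a := by simp [wt, fenum_ins, hji]
    have e2 : wt i (ins j a) = wt i a := by simp [wt, fenum_ins, hij]
    rw [e, e1, e2]; ring
  have hYv : ∀ j x, Y j (vvec x) = (bt (x j) : ℂ) • vvec x := by
    intro j x
    ext a
    rw [hY]
    exact wt_mul_vcoef x j a
  have hsum : Summable (fun j => (2 * Real.pi * Complex.I * t j : ℂ) • Y j) := by
    refine summable_smul_of_bound Y hYn _ (2 * Real.pi) fun j => ?_
    have : ‖(2 * Real.pi * Complex.I * t j : ℂ)‖ = 2 * Real.pi * t j := by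
      simp [abs_of_pos Real.pi_pos, abs_of_pos (hpos j)]
    rw [this]
    exact mul_le_mul_of_nonneg_left (ht4 j) (by positivity)
  refine ⟨NormedSpace.exp (∑' j, (2 * Real.pi * Complex.I * t j : ℂ) • Y j), ?_,
    tendsto_pow Y hidem hcomm hYn n t hpos ht4 hr hr0⟩
  have heig : ∀ x, NormedSpace.exp (∑' j, (2 * Real.pi * Complex.I * t j : ℂ) • Y j) (vvec x)
      = lam t x • vvec x := by
    intro x
    refine exp_eigen _ _ _ ?_
    have h1 := hsum.hasSum.mapL (ContinuousLinearMap.apply ℂ _ (vvec x))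
    have h2 : HasSum (fun j => (2 * Real.pi * Complex.I * ((t j * bt (x j) : ℝ) : ℂ)))
        (2 * Real.pi * Complex.I * ((∑' j, t j * bt (x j) : ℝ) : ℂ)) :=
      (Complex.hasSum_ofReal.2 (summable_bt t hpos ht x).hasSum).mul_left _
    refine h1.unique ((h2.smul_const (vvec x)).congr_fun fun j => ?_)
    simp only [ContinuousLinearMap.apply_apply, smul_apply, hYv, smul_smul]
    congr 1
    push_cast; ring
  have ht0 : t 0 ≤ 1/4 := by simpa using ht4 0
  have hlm : Measurable (lam t) := (lam_continuous t hpos ht).measurable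
  refine ⟨coin.map (lam t), Measure.isProbabilityMeasure_map hlm.aemeasurable, ?_, ?_, ?_⟩
  · rw [Measure.map_apply hlm]
    · have : lam t ⁻¹' {z : ℂ | ‖z‖ = 1}ᶜ = ∅ := by
        ext x; simp [norm_lam]
      rw [this, measure_empty]
    · exact (isClosed_eq continuous_norm continuous_const).measurableSet.compl
  · intro z
    rw [Measure.map_apply hlm (measurableSet_singleton z)]
    have hss : (lam t ⁻¹' {z}).Subsingleton := by
      intro x hx y hy
      apply lam_injective t hpos ht ht0
      rw [Set.mem_preimage, Set.mem_singleton_iff] at hx hy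
      rw [hx, hy]
    rcases hss.eq_empty_or_singleton with h | ⟨x, h⟩
    · rw [h, measure_empty]
    · rw [h, coin_singleton]
  · intro B hB _ hB1
    rw [Measure.map_apply hlm hB] at hB1
    have hd := dense_of_full _ (hlm hB) hB1
    rw [Submodule.topologicalClosure_eq_top_iff, Submodule.eq_bot_iff]
    intro f hf
    apply eq_zero_of_inner
    have hc : (fun x => inner ℂ (vvec x) f) = fun _ => (0:ℂ) := by
      refine Continuous.ext_on hd (continuous_inner_vvec f) continuous_const fun x hx => ?_
      refine (Submodule.mem_orthogonal _ _).1 hf (vvec x) ?_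
      refine Submodule.mem_iSup_of_mem (lam t x) (Submodule.mem_iSup_of_mem hx ?_)
      rw [Module.End.mem_eigenspace_iff]
      exact heig x
    exact fun x => congrFun hc x

/-- Corollary 1.6: if `n_{k+1}/n_k → ∞`, or if `n_k ∣ n_{k+1}` for every `k` and
`limsup n_{k+1}/n_k = +∞`, then `(n_k)` is a uniform rigidity sequence for linear
dynamical systems: there is a bounded operator on `ℓ²(ℕ)` with perfectly spanning
unimodular eigenvectors such that `‖T^{n_k} - I‖ → 0`. -/
theorem uniform_rigidity_of_ratio_or_divisibility
    (n : ℕ → ℕ) (hmono : StrictMono n) (hpos : ∀ k, 0 < n k)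
    (h : Tendsto (fun k => (n (k + 1) : ℝ) / (n k : ℝ)) atTop atTop ∨
      ((∀ k, n k ∣ n (k + 1)) ∧ ∀ C : ℝ, ∃ k, C ≤ (n (k + 1) : ℝ) / (n k : ℝ))) :
    ∃ T : (lp (fun _ : ℕ => ℂ) 2) →L[ℂ] (lp (fun _ : ℕ => ℂ) 2),
      PerfectlySpanning T ∧ Tendsto (fun k => ‖T ^ (n k) - 1‖) atTop (𝓝 0) := by
  have hE : ∀ ε : ℝ, 0 < ε → ∃ t : ℝ, 0 < t ∧ t < ε ∧
      (∀ k, |(n k : ℝ) * t - round ((n k : ℝ) * t)| ≤ ε) ∧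
      Tendsto (fun k => |(n k : ℝ) * t - round ((n k : ℝ) * t)|) atTop (𝓝 0) := by
    rcases h with h | ⟨hd, hC⟩
    · exact exists_small_ratio n hmono hpos h
    · exact exists_small_div n hmono hpos hd hC
  obtain ⟨t, h1, h2, h3, h4, h5⟩ := exists_seq n hE
  exact main_of_seq n t h1 h2 h3 h4 h5
end

section
/- Let (n_k)_{k≥0} be a strictly increasing sequence of positive integers such that n_k divides n_{k+1} for every k ≥ 0. Then (n_k)_{k≥0} is a rigidity sequence: there exists a continuous (atomless) Borel probability measure σ on 𝕋 such that ∫_𝕋 z^{n_k} dσ(z) → 1 as k → ∞. -/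
open MeasureTheory Filter Topology

noncomputable section RigidityAux

/-- The index chosen in the dyadic block `[2^m, 2^(m+1))` by the parameter `t ∈ [1,2)`. -/
def rigJ (m : ℕ) (t : ℝ) : ℕ := ⌊(2:ℝ) ^ m * t⌋₊

/-- The random phase. -/
def rigX (n : ℕ → ℕ) (t : ℝ) : ℝ := ∑' m, 1 / (n (rigJ m t) : ℝ)

lemma rigJ_meas (m : ℕ) : Measurable (rigJ m) :=
  Nat.measurable_floor.comp (measurable_const.mul measurable_id)

lemma rigJ_ge {t : ℝ} (ht : 1 ≤ t) (m : ℕ) : 2 ^ m ≤ rigJ m t := by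
  apply Nat.le_floor
  push_cast
  have : (0:ℝ) < 2 ^ m := by positivity
  nlinarith

lemma rigJ_lt {t : ℝ} (h1 : 1 ≤ t) (ht : t < 2) (m : ℕ) : rigJ m t < 2 ^ (m + 1) := by
  have : (0:ℝ) < 2 ^ m := by positivity
  rw [rigJ, Nat.floor_lt (by positivity)]
  push_cast
  rw [pow_succ]
  nlinarith

lemma rigX_meas (n : ℕ → ℕ) : Measurable (rigX n) := by
  unfold rigX
  apply Measurable.tsum
  intro m
  exact (measurable_from_nat (f := fun j => 1 / (n j : ℝ))).comp (rigJ_meas m)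

lemma rig_growth (n : ℕ → ℕ) (hmono : StrictMono n) (hpos : ∀ k, 0 < n k)
    (hdvd : ∀ k, n k ∣ n (k + 1)) (k i : ℕ) : 2 ^ i * n k ≤ n (i + k) := by
  induction i with
  | zero => simp
  | succ i ih =>
    obtain ⟨c, hc⟩ := hdvd (i + k)
    have h1 : n (i + k) < n (i + k + 1) := hmono (Nat.lt_succ_self _)
    have h2 : 2 ≤ c := by
      by_contra h
      have : c ≤ 1 := by omega
      nlinarith [hpos (i + k)]
    have h3 : i + 1 + k = i + k + 1 := by ring
    rw [h3, hc, pow_succ]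
    nlinarith

lemma rig_dvd (n : ℕ → ℕ) (hdvd : ∀ k, n k ∣ n (k + 1)) {j k : ℕ} (h : j ≤ k) : n j ∣ n k := by
  induction h with
  | refl => exact dvd_rfl
  | step _ ih => exact ih.trans (hdvd _)

lemma rig_term (n : ℕ → ℕ) (hmono : StrictMono n) (hpos : ∀ k, 0 < n k)
    (hdvd : ∀ k, n k ∣ n (k + 1)) {t : ℝ} (ht : 1 ≤ t) (m : ℕ) :
    1 / (n (rigJ m t) : ℝ) ≤ 1 / 2 * (1 / 2) ^ m := by
  have h1 : 2 ^ (m + 1) ≤ n (rigJ m t) := by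
    have a := rig_growth n hmono hpos hdvd 0 (rigJ m t)
    have b : m + 1 ≤ rigJ m t := (Nat.lt_two_pow_self (n := m)).trans_le (rigJ_ge ht m)
    have c : 2 ^ (m + 1) ≤ 2 ^ (rigJ m t) := Nat.pow_le_pow_right (by norm_num) b
    have d := hpos 0
    simp only [add_zero] at a
    nlinarith
  have h2 : (2:ℝ) ^ (m + 1) ≤ n (rigJ m t) := by exact_mod_cast h1
  calc 1 / (n (rigJ m t) : ℝ) ≤ 1 / 2 ^ (m + 1) := one_div_le_one_div_of_le (by positivity) h2
    _ = _ := by rw [one_div_pow, pow_succ]; field_simp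

lemma rig_geo : Summable (fun m : ℕ => (1 / 2 : ℝ) * (1 / 2) ^ m) :=
  summable_geometric_two.mul_left _

lemma rig_summable (n : ℕ → ℕ) (hmono : StrictMono n) (hpos : ∀ k, 0 < n k)
    (hdvd : ∀ k, n k ∣ n (k + 1)) {t : ℝ} (ht : 1 ≤ t) :
    Summable (fun m => 1 / (n (rigJ m t) : ℝ)) :=
  Summable.of_nonneg_of_le (fun _ => by positivity) (rig_term n hmono hpos hdvd ht) rig_geo

lemma rigX_le (n : ℕ → ℕ) (hmono : StrictMono n) (hpos : ∀ k, 0 < n k)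
    (hdvd : ∀ k, n k ∣ n (k + 1)) {t : ℝ} (ht : 1 ≤ t) : rigX n t ≤ 1 := by
  calc rigX n t ≤ ∑' m : ℕ, (1 / 2 : ℝ) * (1 / 2) ^ m :=
        Summable.tsum_le_tsum (rig_term n hmono hpos hdvd ht)
          (rig_summable n hmono hpos hdvd ht) rig_geo
    _ = 1 := by rw [tsum_mul_left, tsum_geometric_two]; norm_num

lemma rigX_pos (n : ℕ → ℕ) (hmono : StrictMono n) (hpos : ∀ k, 0 < n k)
    (hdvd : ∀ k, n k ∣ n (k + 1)) {t : ℝ} (ht : 1 ≤ t) : 0 < rigX n t := by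
  apply (rig_summable n hmono hpos hdvd ht).tsum_pos (fun _ => by positivity) 0
  have := hpos (rigJ 0 t)
  positivity

lemma rigX_anti (n : ℕ → ℕ) (hmono : StrictMono n) (hpos : ∀ k, 0 < n k)
    (hdvd : ∀ k, n k ∣ n (k + 1)) {s t : ℝ} (hs : 1 ≤ s) (hst : s < t) :
    rigX n t < rigX n s := by
  have hp : ∀ j, (0:ℝ) < n j := fun j => by exact_mod_cast hpos j
  obtain ⟨m, hm⟩ := pow_unbounded_of_one_lt (1 / (t - s)) (one_lt_two (α := ℝ))
  have hlt : rigJ m s < rigJ m t := by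
    have h0 : 0 < t - s := by linarith
    rw [div_lt_iff₀ h0] at hm
    have h1 : ((rigJ m s : ℕ) : ℝ) ≤ 2 ^ m * s := Nat.floor_le (by positivity)
    apply Nat.lt_of_succ_le
    apply Nat.le_floor
    push_cast
    nlinarith
  apply Summable.tsum_lt_tsum (i := m) _ _ (rig_summable n hmono hpos hdvd (hs.trans hst.le))
    (rig_summable n hmono hpos hdvd hs)
  · intro i
    apply one_div_le_one_div_of_le (hp _)
    have : rigJ i s ≤ rigJ i t := Nat.floor_mono (by gcongr)
    exact_mod_cast hmono.monotone this
  · apply one_div_lt_one_div_of_lt (hp _)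
    exact_mod_cast hmono hlt

/-- base measure -/
def rigμ : Measure ℝ := volume.restrict (Set.Ico 1 2)

instance : IsProbabilityMeasure rigμ := ⟨by
  rw [rigμ, Measure.restrict_apply_univ, Real.volume_Ico]; norm_num⟩

lemma rig_prob {j : ℕ} (hj : 0 < j) :
    ∑' m, rigμ (rigJ m ⁻¹' {j}) ≤ ENNReal.ofReal (2 / j) := by
  rw [tsum_eq_single (Nat.log 2 j)]
  · set m := Nat.log 2 j with hm
    have hp : (0:ℝ) < 2 ^ m := by positivity
    have hsub : rigJ m ⁻¹' {j} ∩ Set.Ico 1 2 ⊆ Set.Icc ((j:ℝ) / 2 ^ m) ((j + 1) / 2 ^ m) := by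
      rintro t ⟨h, h1, h2⟩
      simp only [Set.mem_preimage, Set.mem_singleton_iff, rigJ] at h
      rw [Nat.floor_eq_iff (by positivity)] at h
      constructor
      · rw [div_le_iff₀ hp]; linarith [h.1]
      · rw [le_div_iff₀ hp]; linarith [h.2]
    rw [rigμ, Measure.restrict_apply (rigJ_meas m (measurableSet_singleton j))]
    refine (measure_mono hsub).trans ?_
    rw [Real.volume_Icc]
    apply ENNReal.ofReal_le_ofReal
    have hjlt : j < 2 ^ (m + 1) := Nat.lt_pow_succ_log_self (by norm_num) j
    have hjlt' : (j:ℝ) < 2 ^ (m + 1) := by exact_mod_cast hjlt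
    have hj' : (0:ℝ) < j := by exact_mod_cast hj
    have : ((j:ℝ) + 1) / 2 ^ m - j / 2 ^ m = 1 / 2 ^ m := by ring
    rw [this, div_le_div_iff₀ hp hj']
    rw [pow_succ] at hjlt'
    linarith
  · intro m hm
    rw [rigμ, Measure.restrict_apply (rigJ_meas m (measurableSet_singleton j))]
    convert measure_empty (μ := (volume : Measure ℝ))
    ext t
    simp only [Set.mem_inter_iff, Set.mem_preimage, Set.mem_singleton_iff, Set.mem_Ico,
      Set.mem_empty_iff_false, iff_false]
    rintro ⟨h, h1, h2⟩
    apply hm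
    symm
    apply Nat.log_eq_of_pow_le_of_lt_pow
    · rw [← h]; exact rigJ_ge h1 m
    · rw [← h]; exact rigJ_lt h1 h2 m

lemma rig_lint (f : ℕ → ENNReal) (k : ℕ) (hk : 0 < k) (hf : ∀ j ≤ k, f j = 0) :
    ∫⁻ t, ∑' m, f (rigJ m t) ∂rigμ ≤ ENNReal.ofReal (2 / k) * ∑' j, f j := by
  rw [lintegral_tsum (f := fun m t => f (rigJ m t)) (fun m => ((measurable_from_nat (f := f)).comp (rigJ_meas m)).aemeasurable)]
  have h1 : ∀ m, ∫⁻ t, f (rigJ m t) ∂rigμ = ∑' j, f j * rigμ (rigJ m ⁻¹' {j}) := by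
    intro m
    rw [← lintegral_map (measurable_from_nat (f := f)) (rigJ_meas m), lintegral_countable']
    congr 1; ext j
    rw [Measure.map_apply (rigJ_meas m) (measurableSet_singleton j)]
  simp_rw [h1]
  rw [ENNReal.tsum_comm, ← ENNReal.tsum_mul_left]
  apply ENNReal.tsum_le_tsum
  intro j
  rw [ENNReal.tsum_mul_left, mul_comm]
  rcases le_or_gt j k with h | h
  · simp [hf j h]
  · gcongr
    refine (rig_prob (hk.trans h)).trans ?_
    apply ENNReal.ofReal_le_ofReal
    have : (0:ℝ) < k := by exact_mod_cast hk
    gcongr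

/-- the fractional contribution at level `k` -/
def rigF (n : ℕ → ℕ) (k j : ℕ) : ℝ := if j ≤ k then 0 else (n k : ℝ) / n j

lemma rigF_nonneg (n : ℕ → ℕ) (k j : ℕ) : 0 ≤ rigF n k j := by
  unfold rigF; split_ifs <;> positivity

lemma rigF_sum (n : ℕ → ℕ) (hmono : StrictMono n) (hpos : ∀ k, 0 < n k)
    (hdvd : ∀ k, n k ∣ n (k + 1)) (k : ℕ) :
    ∑' j, ENNReal.ofReal (rigF n k j) ≤ 2 := by
  rw [← ENNReal.summable.sum_add_tsum_nat_add' (k := k)]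
  rw [Finset.sum_eq_zero, zero_add]
  · have : (2:ENNReal) = ∑' i : ℕ, (2⁻¹ : ENNReal) ^ i := by
      rw [ENNReal.tsum_geometric, ENNReal.one_sub_inv_two, inv_inv]
    rw [this]
    apply ENNReal.tsum_le_tsum
    intro i
    have e : (2⁻¹ : ENNReal) ^ i = ENNReal.ofReal ((1 / 2) ^ i) := by
      rw [ENNReal.ofReal_pow (by norm_num)]
      congr 1
      rw [one_div, ENNReal.ofReal_inv_of_pos (by norm_num)]; simp
    rw [e]
    apply ENNReal.ofReal_le_ofReal
    unfold rigF
    split_ifs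
    · positivity
    · have h := rig_growth n hmono hpos hdvd k i
      have h' : (2:ℝ) ^ i * n k ≤ n (i + k) := by exact_mod_cast h
      have hp : (0:ℝ) < n (i + k) := by exact_mod_cast hpos _
      rw [div_le_iff₀ hp, one_div_pow, one_div, ← div_eq_inv_mul, le_div_iff₀ (by positivity)]
      linarith
  · intro i hi
    rw [Finset.mem_range] at hi
    simp [rigF, hi.le]

/-- The point on the circle. -/
def rigZ (n : ℕ → ℕ) (t : ℝ) : ℂ := Complex.exp (Complex.I * ((2 * Real.pi * rigX n t : ℝ) : ℂ))

lemma rigZ_meas (n : ℕ → ℕ) : Measurable (rigZ n) := by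
  unfold rigZ
  have := rigX_meas n
  fun_prop

lemma rigZ_pow (n : ℕ → ℕ) (hmono : StrictMono n) (hpos : ∀ k, 0 < n k)
    (hdvd : ∀ k, n k ∣ n (k + 1)) {t : ℝ} (ht : 1 ≤ t) (k : ℕ) :
    ‖rigZ n t ^ n k - 1‖ₑ ≤
      ENNReal.ofReal (2 * Real.pi) * ∑' m, ENNReal.ofReal (rigF n k (rigJ m t)) := by
  have hS := (rig_summable n hmono hpos hdvd ht).mul_left (n k : ℝ)
  have hF : Summable (fun m => rigF n k (rigJ m t)) := by
    refine Summable.of_nonneg_of_le (fun _ => rigF_nonneg _ _ _) (fun m => ?_) hS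
    unfold rigF
    split_ifs
    · positivity
    · rw [mul_one_div]
  have hX : (n k : ℝ) * rigX n t =
      ((∑ m ∈ Finset.range (k + 1), (if rigJ m t ≤ k then n k / n (rigJ m t) else 0) : ℕ) : ℝ)
        + ∑' m, rigF n k (rigJ m t) := by
    rw [rigX, ← tsum_mul_left, ← sub_eq_iff_eq_add, ← hS.tsum_sub hF,
      tsum_eq_sum (s := Finset.range (k + 1))]
    · push_cast
      apply Finset.sum_congr rfl
      intro m _
      unfold rigF
      split_ifs with h
      · have := (hpos (rigJ m t)).ne'
        rw [Nat.cast_div (rig_dvd n hdvd h) (by exact_mod_cast this)]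
        ring
      · push_cast; ring
    · intro m hm
      have h1 : k < rigJ m t := by
        have := (Nat.lt_two_pow_self (n := m)).trans_le (rigJ_ge ht m)
        simp only [Finset.mem_range] at hm
        omega
      rw [rigF, if_neg (by omega)]
      ring
  set N := ∑ m ∈ Finset.range (k + 1), (if rigJ m t ≤ k then n k / n (rigJ m t) else 0) with hN
  set R := ∑' m, rigF n k (rigJ m t) with hR
  have hR0 : 0 ≤ R := tsum_nonneg (fun _ => rigF_nonneg _ _ _)
  have hz : rigZ n t ^ n k = Complex.exp (Complex.I * ((2 * Real.pi * R : ℝ) : ℂ)) := by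
    rw [rigZ, ← Complex.exp_nat_mul]
    rw [Complex.exp_eq_exp_iff_exists_int]
    refine ⟨N, ?_⟩
    have hX' : (n k : ℂ) * (rigX n t : ℂ) = N + R := by exact_mod_cast congrArg Complex.ofReal hX
    push_cast
    linear_combination (2 * Real.pi * Complex.I) * hX'
  rw [hz]
  refine Real.enorm_exp_I_mul_ofReal_sub_one_le.trans ?_
  rw [← ENNReal.ofReal_tsum_of_nonneg (fun _ => rigF_nonneg _ _ _) hF,
    ← ENNReal.ofReal_mul (by positivity), Real.enorm_eq_ofReal (by positivity)]

lemma rigZ_inj (n : ℕ → ℕ) (hmono : StrictMono n) (hpos : ∀ k, 0 < n k)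
    (hdvd : ∀ k, n k ∣ n (k + 1)) {s t : ℝ} (hs : 1 ≤ s) (ht : 1 ≤ t)
    (h : rigZ n s = rigZ n t) : s = t := by
  have hx : rigX n s = rigX n t := by
    rw [rigZ, rigZ, Complex.exp_eq_exp_iff_exists_int] at h
    obtain ⟨N, hN⟩ := h
    have e : (rigX n s : ℂ) = rigX n t + N := by
      have : (2 * Real.pi * Complex.I : ℂ) ≠ 0 := Complex.two_pi_I_ne_zero
      apply mul_left_cancel₀ this
      push_cast at hN
      linear_combination hN
    have e' : rigX n s = rigX n t + N := by exact_mod_cast e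
    have a1 := rigX_pos n hmono hpos hdvd hs
    have a2 := rigX_pos n hmono hpos hdvd ht
    have a3 := rigX_le n hmono hpos hdvd hs
    have a4 := rigX_le n hmono hpos hdvd ht
    have b1 : (N:ℝ) < 1 := by linarith
    have b2 : (-1:ℝ) < N := by linarith
    have c1 : N < 1 := by exact_mod_cast b1
    have c2 : -1 < N := by exact_mod_cast b2
    have : N = 0 := by omega
    simpa [this] using e'
  rcases lt_trichotomy s t with h1 | h1 | h1
  · linarith [rigX_anti n hmono hpos hdvd hs h1]
  · exact h1
  · linarith [rigX_anti n hmono hpos hdvd ht h1]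

end RigidityAux

/-- Proposition 3.8: if `n_k ∣ n_{k+1}` for every `k`, then `(n_k)` is a rigidity sequence:
there is a continuous (atomless) probability measure `σ` on the unit circle such that
`∫ z^{n_k} dσ(z) → 1`. -/
theorem rigidity_sequence_of_dvd
    (n : ℕ → ℕ) (hmono : StrictMono n) (hpos : ∀ k, 0 < n k)
    (hdvd : ∀ k, n k ∣ n (k + 1)) :
    ∃ σ : Measure ℂ, IsProbabilityMeasure σ ∧ σ {z : ℂ | ‖z‖ = 1}ᶜ = 0 ∧
      (∀ z : ℂ, σ {z} = 0) ∧
      Tendsto (fun k => ∫ z : ℂ, z ^ (n k) ∂σ) atTop (𝓝 1) := by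
  have hZ := rigZ_meas n
  have hnorm : ∀ t, ‖rigZ n t‖ = 1 := fun t => by
    rw [rigZ, mul_comm]; exact Complex.norm_exp_ofReal_mul_I _
  refine ⟨rigμ.map (rigZ n), Measure.isProbabilityMeasure_map hZ.aemeasurable, ?_, ?_, ?_⟩
  · rw [Measure.map_apply hZ]
    · convert measure_empty (μ := rigμ)
      ext t
      simp [hnorm]
    · exact (measurableSet_eq_fun measurable_norm measurable_const).compl
  · intro z
    rw [Measure.map_apply hZ (measurableSet_singleton z), rigμ,
      Measure.restrict_apply (hZ (measurableSet_singleton z))]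
    apply Set.Subsingleton.measure_zero
    rintro s ⟨hs, hs1, _⟩ t ⟨ht, ht1, _⟩
    simp only [Set.mem_preimage, Set.mem_singleton_iff] at hs ht
    exact rigZ_inj n hmono hpos hdvd hs1 ht1 (hs.trans ht.symm)
  · have hmain : ∀ k, 0 < k → ‖(∫ z : ℂ, z ^ (n k) ∂(rigμ.map (rigZ n))) - 1‖ₑ ≤
        ENNReal.ofReal (2 * Real.pi) * (ENNReal.ofReal (2 / k) * 2) := by
      intro k hk
      have hint : Integrable (fun t => rigZ n t ^ n k) rigμ := by
        refine Integrable.of_bound (hZ.pow_const _).aestronglyMeasurable 1 ?_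
        filter_upwards with t
        simp [hnorm]
      rw [integral_map hZ.aemeasurable (by fun_prop)]
      have e : (∫ t, rigZ n t ^ n k ∂rigμ) - 1 = ∫ t, (rigZ n t ^ n k - 1) ∂rigμ := by
        rw [integral_sub hint (integrable_const _)]; simp
      rw [e]
      refine (enorm_integral_le_lintegral_enorm _).trans ?_
      calc ∫⁻ t, ‖rigZ n t ^ n k - 1‖ₑ ∂rigμ
          ≤ ∫⁻ t, ENNReal.ofReal (2 * Real.pi) *
              ∑' m, ENNReal.ofReal (rigF n k (rigJ m t)) ∂rigμ := by
            apply lintegral_mono_ae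
            have : ∀ᵐ t ∂rigμ, t ∈ Set.Ico (1:ℝ) 2 := ae_restrict_mem measurableSet_Ico
            filter_upwards [this] with t ht
            exact rigZ_pow n hmono hpos hdvd ht.1 k
        _ = ENNReal.ofReal (2 * Real.pi) *
              ∫⁻ t, ∑' m, ENNReal.ofReal (rigF n k (rigJ m t)) ∂rigμ :=
            lintegral_const_mul' _ _ ENNReal.ofReal_ne_top
        _ ≤ _ := by
            gcongr
            refine (rig_lint (fun j => ENNReal.ofReal (rigF n k j)) k hk ?_).trans ?_
            · intro j hj
              simp [rigF, hj]
            · gcongr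
              exact rigF_sum n hmono hpos hdvd k
    rw [tendsto_iff_norm_sub_tendsto_zero]
    have hlim : Tendsto (fun k : ℕ => 8 * Real.pi / (k:ℝ)) atTop (𝓝 0) :=
      tendsto_const_div_atTop_nhds_zero_nat _
    refine tendsto_of_tendsto_of_tendsto_of_le_of_le' tendsto_const_nhds hlim
      (Eventually.of_forall fun _ => norm_nonneg _) ?_
    filter_upwards [eventually_gt_atTop 0] with k hk
    have h := hmain k hk
    have e2 : (2:ENNReal) = ENNReal.ofReal 2 := by simp
    rw [e2, ← ENNReal.ofReal_mul (by positivity), ← ENNReal.ofReal_mul (by positivity),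
      ← ofReal_norm_eq_enorm, ENNReal.ofReal_le_ofReal_iff (by positivity)] at h
    refine h.trans (le_of_eq ?_)
    ring
end

section
/- Let p ∈ ℤ[X] be a nonconstant polynomial with nonnegative coefficients. Then for every continuous (atomless) Borel probability measure σ on 𝕋, the Cesàro averages (1/N) Σ_{k=1}^{N} ∫_𝕋 z^{p(k)} dσ(z) tend to 0 as N → ∞; in particular ∫_𝕋 z^{p(k)} dσ(z) does not tend to 1 as k → ∞, so the sequence (p(k))_{k≥0} is not a rigidity sequence. -/
open MeasureTheory Filter Topology

theorem aux_Icc (f : ℕ → ℂ) (N : ℕ) :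
    ∑ k ∈ Finset.Icc 1 N, f k = ∑ k ∈ Finset.range N, f (k + 1) := by
  induction N with
  | zero => simp
  | succ N ih => rw [Finset.sum_Icc_succ_top (by omega), ih, Finset.sum_range_succ]

theorem aux_shift (u : ℕ → ℂ) (hu : ∀ k, ‖u k‖ ≤ 1) (N h : ℕ) :
    ‖∑ k ∈ Finset.range N, u k - ∑ k ∈ Finset.range N, u (k + h)‖ ≤ 2 * h := by
  have e : ∑ k ∈ Finset.range N, u k - ∑ k ∈ Finset.range N, u (k + h)
      = ∑ k ∈ Finset.range h, u k - ∑ k ∈ Finset.range h, u (N + k) := by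
    have h1 := Finset.sum_range_add u N h
    have h2 := Finset.sum_range_add u h N
    rw [add_comm h N] at h2
    have h3 : ∑ k ∈ Finset.range N, u (k + h) = ∑ k ∈ Finset.range N, u (h + k) :=
      Finset.sum_congr rfl fun k _ => by rw [add_comm]
    rw [h3]
    linear_combination h2 - h1
  have b : ∀ w : ℕ → ℂ, (∀ k, ‖w k‖ ≤ 1) → ‖∑ k ∈ Finset.range h, w k‖ ≤ h := fun w hw => by
    simpa using norm_sum_le_of_le (Finset.range h) (f := w) (n := fun _ => (1:ℝ)) (fun k _ => hw k)
  rw [e]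
  have := norm_sub_le (∑ k ∈ Finset.range h, u k) (∑ k ∈ Finset.range h, u (N + k))
  have h1 := b u hu
  have h2 := b (fun k => u (N + k)) (fun k => hu _)
  linarith

theorem aux_vdc (u : ℕ → ℂ) (hu : ∀ k, ‖u k‖ ≤ 1)
    (H0 : ∀ h h' : ℕ, h ≠ h' → Tendsto (fun N : ℕ => (N : ℂ)⁻¹ *
      ∑ k ∈ Finset.range N, u (k + h) * (starRingEnd ℂ) (u (k + h'))) atTop (𝓝 0)) :
    Tendsto (fun N : ℕ => (N : ℂ)⁻¹ * ∑ k ∈ Finset.range N, u k) atTop (𝓝 0) := by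
  set A : ℕ → ℕ → ℕ → ℂ := fun h h' N => (N : ℂ)⁻¹ *
      ∑ k ∈ Finset.range N, u (k + h) * (starRingEnd ℂ) (u (k + h')) with hA
  have key : ∀ H : ℕ, 0 < H → ∀ N : ℕ, 0 < N →
      ‖(N : ℂ)⁻¹ * ∑ k ∈ Finset.range N, u k‖ ≤
      (√(H + ∑ h ∈ Finset.range H, ∑ h' ∈ Finset.range H, if h = h' then 0 else ‖A h h' N‖)
        + 2 * H ^ 2 * (N : ℝ)⁻¹) / H := by
    intro H hH N hN
    have hHr : (0:ℝ) < H := by exact_mod_cast hH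
    have hNr : (0:ℝ) < N := by exact_mod_cast hN
    have hNc : (N:ℂ) ≠ 0 := by exact_mod_cast hN.ne'
    set E : ℝ := ∑ h ∈ Finset.range H, ∑ h' ∈ Finset.range H, if h = h' then 0 else ‖A h h' N‖
    set v : ℕ → ℂ := fun k => ∑ h ∈ Finset.range H, u (k + h) with hv
    -- step 1
    have s1 : (H:ℝ) * ‖∑ k ∈ Finset.range N, u k‖ ≤ ‖∑ k ∈ Finset.range N, v k‖ + 2 * H ^ 2 := by
      have e : (H:ℂ) * ∑ k ∈ Finset.range N, u k = ∑ k ∈ Finset.range N, v k +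
          ∑ h ∈ Finset.range H, (∑ k ∈ Finset.range N, u k - ∑ k ∈ Finset.range N, u (k + h)) := by
        simp only [hv]
        rw [Finset.sum_comm, ← Finset.sum_add_distrib]
        simp
      have e2 : ‖∑ h ∈ Finset.range H, (∑ k ∈ Finset.range N, u k -
          ∑ k ∈ Finset.range N, u (k + h))‖ ≤ 2 * H ^ 2 := by
        have := norm_sum_le_of_le (Finset.range H) (f := fun h => (∑ k ∈ Finset.range N, u k -
          ∑ k ∈ Finset.range N, u (k + h))) (n := fun _ => 2 * (H:ℝ)) (fun h hh => by
            have h1 := aux_shift u hu N h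
            have h2 : (h:ℝ) ≤ H := by exact_mod_cast (Finset.mem_range.1 hh).le
            linarith)
        refine this.trans (le_of_eq ?_)
        simp; ring
      have e3 := congrArg norm e
      rw [norm_mul, Complex.norm_natCast] at e3
      rw [e3]
      exact (norm_add_le _ _).trans (by linarith)
    -- step 2
    have s2 : ‖∑ k ∈ Finset.range N, v k‖ ^ 2 ≤ N * ∑ k ∈ Finset.range N, ‖v k‖ ^ 2 := by
      have h1 := norm_sum_le (Finset.range N) v
      have h2 := sq_sum_le_card_mul_sum_sq (s := Finset.range N) (f := fun k => ‖v k‖)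
      rw [Finset.card_range] at h2
      exact (pow_le_pow_left₀ (norm_nonneg _) h1 2).trans h2
    -- step 3
    have s3 : ∑ k ∈ Finset.range N, ‖v k‖ ^ 2 ≤ N * (H + E) := by
      have e : ((∑ k ∈ Finset.range N, ‖v k‖ ^ 2 : ℝ) : ℂ) =
          N * ∑ h ∈ Finset.range H, ∑ h' ∈ Finset.range H, A h h' N := by
        push_cast
        have : ∀ k, ((‖v k‖ : ℂ)) ^ 2 = ∑ h ∈ Finset.range H, ∑ h' ∈ Finset.range H,
            u (k + h) * (starRingEnd ℂ) (u (k + h')) := by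
          intro k
          rw [← Complex.mul_conj', hv, map_sum, Finset.sum_mul_sum]
        simp only [this, hA]
        rw [Finset.sum_comm, Finset.mul_sum]
        refine Finset.sum_congr rfl fun h _ => ?_
        rw [Finset.sum_comm, Finset.mul_sum]
        refine Finset.sum_congr rfl fun h' _ => ?_
        rw [mul_inv_cancel_left₀ hNc]
      have e2 : ‖∑ h ∈ Finset.range H, ∑ h' ∈ Finset.range H, A h h' N‖ ≤ H + E := by
        have hd : ∀ h, ‖A h h N‖ ≤ 1 := by
          intro h
          simp only [hA]
          rw [norm_mul, norm_inv, Complex.norm_natCast, inv_mul_le_iff₀ hNr]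
          refine (norm_sum_le_of_le _ (n := fun _ => (1:ℝ)) fun k _ => ?_).trans (by simp)
          rw [norm_mul, RCLike.norm_conj]
          exact mul_le_one₀ (hu _) (norm_nonneg _) (hu _)
        calc _ ≤ ∑ h ∈ Finset.range H, ∑ h' ∈ Finset.range H, ((if h = h' then (1:ℝ) else 0) +
                (if h = h' then 0 else ‖A h h' N‖)) := by
              refine norm_sum_le_of_le _ fun h _ => norm_sum_le_of_le _ fun h' _ => ?_
              split_ifs with hh
              · subst hh; simpa using hd h
              · simp
          _ ≤ H + E := by
              simp only [Finset.sum_add_distrib]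
              refine add_le_add ?_ le_rfl
              refine (Finset.sum_le_card_nsmul _ _ 1 fun h hh => ?_).trans (by simp)
              rw [Finset.sum_ite_eq, if_pos hh]
      have e3 := congrArg norm e
      rw [norm_mul, Complex.norm_natCast, Complex.norm_real, Real.norm_eq_abs] at e3
      refine (le_abs_self _).trans ?_
      rw [e3]
      gcongr
    have s4 : ‖∑ k ∈ Finset.range N, v k‖ ≤ N * √(H + E) := by
      have hE : 0 ≤ (H:ℝ) + E := by
        by_contra hc
        push Not at hc
        have : 0 ≤ ∑ k ∈ Finset.range N, ‖v k‖ ^ 2 := Finset.sum_nonneg fun _ _ => by positivity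
        nlinarith
      refine abs_le_of_sq_le_sq' ?_ (by positivity) |>.2
      rw [mul_pow, Real.sq_sqrt hE]
      nlinarith
    rw [norm_mul, norm_inv, Complex.norm_natCast, le_div_iff₀ hHr, mul_assoc, inv_mul_le_iff₀ hNr]
    have : (N:ℝ) * (√(H + E) + 2 * H ^ 2 * (N : ℝ)⁻¹) = N * √(H + E) + 2 * H ^ 2 := by
      field_simp
    rw [this]
    linarith
  rw [tendsto_zero_iff_norm_tendsto_zero]
  have lim : ∀ H : ℕ, Tendsto (fun N : ℕ =>
      (√(H + ∑ h ∈ Finset.range H, ∑ h' ∈ Finset.range H, if h = h' then 0 else ‖A h h' N‖)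
        + 2 * (H:ℝ) ^ 2 * (N : ℝ)⁻¹) / H) atTop (𝓝 ((√(H + ∑ h ∈ Finset.range H,
          ∑ h' ∈ Finset.range H, 0) + 2 * (H:ℝ) ^ 2 * 0) / H)) := by
    intro H
    refine Tendsto.div_const (Tendsto.add (Tendsto.sqrt (Tendsto.add tendsto_const_nhds ?_))
      (tendsto_const_nhds.mul tendsto_inv_atTop_nhds_zero_nat)) _
    refine tendsto_finsetSum _ fun h _ => tendsto_finsetSum _ fun h' _ => ?_
    split_ifs with hh
    · exact tendsto_const_nhds
    · exact tendsto_zero_iff_norm_tendsto_zero.1 (H0 h h' hh)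
  rw [Metric.tendsto_atTop']
  intro ε hε
  obtain ⟨H, hH⟩ := exists_nat_gt (1 / ε ^ 2)
  have hHr : (0:ℝ) < H := lt_trans (by positivity) hH
  have l := lim H
  have hlt : (√(H + ∑ h ∈ Finset.range H, ∑ h' ∈ Finset.range H, (0:ℝ)) + 2 * (H:ℝ) ^ 2 * 0) / H
      < ε := by
    simp only [Finset.sum_const_zero, mul_zero, add_zero]
    rw [div_lt_iff₀ hHr, Real.sqrt_lt' (by positivity)]
    rw [div_lt_iff₀ (by positivity)] at hH
    nlinarith
  obtain ⟨N0, hN0⟩ := eventually_atTop.1 (l.eventually (gt_mem_nhds hlt))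
  refine ⟨N0, fun N hN => ?_⟩
  rw [Real.dist_0_eq_abs, abs_norm]
  exact (key H (by exact_mod_cast hHr) N (by omega)).trans_lt (hN0 N hN.le)

theorem aux_taylor (p : Polynomial ℤ) (d : ℕ) (hd : p.natDegree = d + 1) (r s : ℤ) (hrs : r ≠ s)
    : (Polynomial.taylor r p - Polynomial.taylor s p).natDegree = d := by
  have hlead : p.coeff (d + 1) ≠ 0 := by
    rw [← hd, ← Polynomial.leadingCoeff]
    intro h
    rw [Polynomial.leadingCoeff_eq_zero] at h
    simp [h] at hd
  apply Polynomial.natDegree_eq_of_le_of_coeff_ne_zero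
  · rw [Polynomial.natDegree_le_iff_coeff_eq_zero]
    intro n hn
    rw [Polynomial.coeff_sub, Polynomial.taylor_coeff, Polynomial.taylor_coeff]
    have : (Polynomial.hasseDeriv n p).natDegree = 0 := by
      have := Polynomial.natDegree_hasseDeriv_le p n
      omega
    rw [Polynomial.eq_C_of_natDegree_eq_zero this]
    simp
  · rw [Polynomial.coeff_sub, Polynomial.taylor_coeff, Polynomial.taylor_coeff]
    have : (Polynomial.hasseDeriv d p).natDegree ≤ 1 := by
      have := Polynomial.natDegree_hasseDeriv_le p d
      omega
    rw [Polynomial.eq_X_add_C_of_natDegree_le_one this]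
    simp only [Polynomial.hasseDeriv_coeff, Polynomial.eval_add, Polynomial.eval_mul,
      Polynomial.eval_C, Polynomial.eval_X]
    have e : ∀ a b : ℤ, a * r + b - (a * s + b) = a * (r - s) := fun a b => by ring
    rw [e, add_comm 1 d]
    refine mul_ne_zero (mul_ne_zero ?_ hlead) (sub_ne_zero.2 hrs)
    have := Nat.choose_pos (Nat.le_succ d)
    exact_mod_cast this.ne'

theorem aux_weyl (z : ℂ) (hz : ‖z‖ = 1) (hroot : ∀ n : ℤ, n ≠ 0 → z ^ n ≠ 1) (d : ℕ) :
    ∀ p : Polynomial ℤ, p.natDegree = d + 1 →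
    Tendsto (fun N : ℕ => (N : ℂ)⁻¹ * ∑ k ∈ Finset.range N, z ^ (p.eval (k : ℤ)))
      atTop (𝓝 0) := by
  have hz0 : z ≠ 0 := by rintro rfl; simp at hz
  have hn : ∀ n : ℤ, ‖z ^ n‖ = 1 := fun n => by rw [norm_zpow, hz, one_zpow]
  induction d with
  | zero =>
    intro p hp
    have ha : p.coeff 1 ≠ 0 := by
      intro h
      have : p.leadingCoeff = 0 := by rw [Polynomial.leadingCoeff, hp]; exact h
      rw [Polynomial.leadingCoeff_eq_zero] at this
      simp [this] at hp
    set a := p.coeff 1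
    set b := p.coeff 0
    have hpe : ∀ k : ℤ, p.eval k = a * k + b := by
      intro k
      conv_lhs => rw [Polynomial.eq_X_add_C_of_natDegree_le_one hp.le]
      simp [a, b]
    have hw := hroot a ha
    have hs : ∀ N : ℕ, ∑ k ∈ Finset.range N, z ^ (p.eval (k : ℤ)) =
        z ^ b * (((z ^ a) ^ N - 1) / (z ^ a - 1)) := by
      intro N
      rw [← geom_sum_eq hw, Finset.mul_sum]
      refine Finset.sum_congr rfl fun k _ => ?_
      rw [hpe, zpow_add₀ hz0, zpow_mul, zpow_natCast, mul_comm]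
    simp only [hs]
    rw [tendsto_zero_iff_norm_tendsto_zero]
    have hl : Tendsto (fun N : ℕ => (N:ℝ)⁻¹ * (2 / ‖z ^ a - 1‖)) atTop (𝓝 0) := by
      simpa using tendsto_inv_atTop_nhds_zero_nat.mul_const (2 / ‖z ^ a - 1‖)
    refine squeeze_zero (fun _ => norm_nonneg _) (fun N => ?_) hl
    rw [norm_mul, norm_mul, hn, one_mul, norm_inv, Complex.norm_natCast, norm_div]
    have : ‖(z ^ a) ^ N - 1‖ ≤ 2 := by
      refine (norm_sub_le _ _).trans ?_
      rw [norm_pow, hn]; norm_num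
    gcongr
  | succ d ih =>
    intro p hp
    refine aux_vdc (fun k => z ^ (p.eval (k:ℤ))) (fun k => (hn _).le) fun h h' hh => ?_
    refine (ih _ (aux_taylor p (d + 1) hp h h' (by exact_mod_cast hh))).congr fun N => ?_
    congr 1
    refine Finset.sum_congr rfl fun k _ => ?_
    rw [Polynomial.eval_sub, Polynomial.taylor_eval, Polynomial.taylor_eval, zpow_sub₀ hz0,
      div_eq_mul_inv, Complex.inv_eq_conj (hn _)]
    push_cast
    rfl

/-- Example 3.10: if `p ∈ ℤ[X]` is a nonconstant polynomial with nonnegative coefficients,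
then for every continuous (atomless) probability measure `σ` on the unit circle the Cesàro
averages `(1/N) ∑_{k=1}^N ∫ z^{p(k)} dσ(z)` tend to `0`; in particular
`∫ z^{p(k)} dσ(z)` does not tend to `1`, so `(p(k))` is not a rigidity sequence. -/
theorem polynomial_not_rigidity_sequence
    (p : Polynomial ℤ) (hdeg : 0 < p.natDegree) (hcoeff : ∀ i, 0 ≤ p.coeff i)
    (σ : Measure ℂ) (hprob : IsProbabilityMeasure σ)
    (hsupp : σ {z : ℂ | ‖z‖ = 1}ᶜ = 0) (hcont : ∀ z : ℂ, σ {z} = 0) :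
    Tendsto (fun N : ℕ => ((N : ℂ))⁻¹ * ∑ k ∈ Finset.Icc 1 N,
        ∫ z : ℂ, z ^ ((p.eval (k : ℤ)).toNat) ∂σ) atTop (𝓝 0) ∧
    ¬ Tendsto (fun k : ℕ => ∫ z : ℂ, z ^ ((p.eval (k : ℤ)).toNat) ∂σ) atTop (𝓝 1) := by
  have hcount : {z : ℂ | ∃ n : ℤ, n ≠ 0 ∧ z ^ n = 1}.Countable := by
    have : {z : ℂ | ∃ n : ℤ, n ≠ 0 ∧ z ^ n = 1} ⊆
        ⋃ n : ℕ, {z : ℂ | z ∈ Polynomial.nthRootsFinset (n + 1) (1:ℂ)} := by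
      rintro z ⟨n, hn, hz⟩
      have h1 : z ^ n.natAbs = 1 := by
        rcases Int.natAbs_eq n with h | h
        · rw [h] at hz; exact_mod_cast hz
        · rw [h, zpow_neg, inv_eq_one] at hz; exact_mod_cast hz
      refine Set.mem_iUnion.2 ⟨n.natAbs - 1, ?_⟩
      have h2 : n.natAbs - 1 + 1 = n.natAbs := by omega
      simp only [Set.mem_ofPred_eq]
      rw [h2, Polynomial.mem_nthRootsFinset (by omega)]
      exact h1
    exact (Set.countable_iUnion fun n => Finset.countable_toSet _).mono this
  have hna : NullSingletonClass σ := ⟨hcont⟩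
  have hae1 : ∀ᵐ z ∂σ, ‖z‖ = 1 := hsupp
  have hae2 : ∀ᵐ z ∂σ, ∀ n : ℤ, n ≠ 0 → z ^ n ≠ 1 := by
    have := hcount.ae_notMem σ
    filter_upwards [this] with z hz n hn h
    exact hz ⟨n, hn, h⟩
  have hnn : ∀ k : ℕ, 0 ≤ p.eval (k:ℤ) := by
    intro k
    rw [Polynomial.eval_eq_sum_range]
    exact Finset.sum_nonneg fun i _ => mul_nonneg (hcoeff i) (by positivity)
  have hint : ∀ n : ℕ, Integrable (fun z : ℂ => z ^ n) σ := fun n => by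
    refine Integrable.of_bound (by fun_prop) 1 ?_
    filter_upwards [hae1] with z hz
    rw [norm_pow, hz, one_pow]
  have hmain : Tendsto (fun N : ℕ => ((N : ℂ))⁻¹ * ∑ k ∈ Finset.Icc 1 N,
        ∫ z : ℂ, z ^ ((p.eval (k : ℤ)).toNat) ∂σ) atTop (𝓝 0) := by
    have e : ∀ N : ℕ, ((N : ℂ))⁻¹ * ∑ k ∈ Finset.Icc 1 N,
        ∫ z : ℂ, z ^ ((p.eval (k : ℤ)).toNat) ∂σ =
        ∫ z : ℂ, (N : ℂ)⁻¹ * ∑ k ∈ Finset.Icc 1 N, z ^ ((p.eval (k : ℤ)).toNat) ∂σ := by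
      intro N
      rw [integral_const_mul, integral_finsetSum _ fun k _ => hint _]
    simp only [e]
    rw [← integral_zero ℂ ℂ (μ := σ)]
    refine tendsto_integral_of_dominated_convergence (fun _ => 1) (fun N => by fun_prop)
      (integrable_const 1) (fun N => ?_) ?_
    · filter_upwards [hae1] with z hz
      rw [norm_mul, norm_inv, Complex.norm_natCast]
      have : ‖∑ k ∈ Finset.Icc 1 N, z ^ ((p.eval (k : ℤ)).toNat)‖ ≤ N := by
        refine (norm_sum_le_of_le _ (n := fun _ => (1:ℝ)) fun k _ => ?_).trans (by simp)
        rw [norm_pow, hz, one_pow]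
      refine (mul_le_mul_of_nonneg_left this (by positivity)).trans ?_
      exact inv_mul_le_one
    · filter_upwards [hae1, hae2] with z hz hr
      obtain ⟨d, hd⟩ : ∃ d, p.natDegree = d + 1 := ⟨p.natDegree - 1, by omega⟩
      refine (aux_weyl z hz hr d (Polynomial.taylor 1 p)
        (by rw [Polynomial.natDegree_taylor, hd])).congr fun N => ?_
      congr 1
      rw [aux_Icc]
      refine Finset.sum_congr rfl fun k _ => ?_
      rw [Polynomial.taylor_eval, ← zpow_natCast, Int.toNat_of_nonneg (hnn _)]
      push_cast
      rfl
  refine ⟨hmain, fun h => ?_⟩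
  have h1 := (h.comp (tendsto_add_atTop_nat 1)).cesaro_smul
  have h2 := tendsto_nhds_unique h1 (hmain.congr fun N => by
    rw [aux_Icc]
    simp)
  exact one_ne_zero h2
end

section
/- Let (n_k)_{k≥0} be the strictly increasing enumeration of the prime numbers. Then (n_k)_{k≥0} is not a rigidity sequence: there is no continuous (atomless) Borel probability measure σ on 𝕋 with ∫_𝕋 z^{n_k} dσ(z) → 1 as k → ∞ (equivalently, there is no weakly mixing measure-preserving transformation of a probability space which is rigid with respect to the sequence of primes). -/
open MeasureTheory Filter Topology

lemma sum_nthRoots_pow (p n : ℕ) (hn : 0 < n) (h : n.Coprime p) :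
    ∑ ω ∈ Polynomial.nthRootsFinset n (1:ℂ), ω ^ p = if n = 1 then 1 else 0 := by
  split_ifs with h1
  · subst h1
    have : Polynomial.nthRootsFinset 1 (1:ℂ) = {1} := by
      ext; simp [Polynomial.mem_nthRootsFinset]
    simp [this]
  · have hζ := Complex.isPrimitiveRoot_exp n hn.ne'
    set ζ := Complex.exp (2 * Real.pi * Complex.I / n) with hζd
    have hζ0 : ζ ≠ 0 := Complex.exp_ne_zero _
    have hζn : ζ ^ n = 1 := hζ.pow_eq_one
    have key : ζ ^ p * ∑ ω ∈ Polynomial.nthRootsFinset n (1:ℂ), ω ^ p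
        = ∑ ω ∈ Polynomial.nthRootsFinset n (1:ℂ), ω ^ p := by
      rw [Finset.mul_sum]
      refine Finset.sum_nbij' (fun ω => ζ * ω) (fun ω => ζ⁻¹ * ω) ?_ ?_ ?_ ?_ ?_
      · intro a ha
        rw [Polynomial.mem_nthRootsFinset hn] at *
        rw [mul_pow, ha, hζn, one_mul]
      · intro a ha
        rw [Polynomial.mem_nthRootsFinset hn] at *
        rw [mul_pow, ha, inv_pow, hζn, inv_one, one_mul]
      · intro a _; field_simp
      · intro a _; field_simp
      · intro a _; rw [mul_pow]
    have hne : ζ ^ p ≠ 1 := by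
      intro h2
      have := (hζ.pow_of_coprime p h.symm).unique (h2 ▸ IsPrimitiveRoot.one)
      exact h1 this
    have h3 : (ζ ^ p - 1) * ∑ ω ∈ Polynomial.nthRootsFinset n (1:ℂ), ω ^ p = 0 := by
      rw [sub_mul, key, one_mul, sub_self]
    exact (mul_eq_zero.mp h3).resolve_left (sub_ne_zero.mpr hne)

lemma ramanujan_sum (p q : ℕ) (hq : 0 < q) (h : q.Coprime p) :
    ∑ ω ∈ primitiveRoots q ℂ, ω ^ p = (ArithmeticFunction.moebius q : ℂ) := by
  have := (ArithmeticFunction.sum_eq_iff_sum_mul_moebius_eq_on (R := ℂ)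
    (f := fun d => ∑ ω ∈ primitiveRoots d ℂ, ω ^ p) (g := fun n => if n = 1 then 1 else 0)
    {d | d.Coprime p} (fun m n hmn hn => Nat.Coprime.coprime_dvd_left hmn hn)).mp ?_ q hq h
  · rw [← this, Finset.sum_eq_single (q, 1)]
    · simp
    · rintro ⟨a, b⟩ hab hne
      rw [Nat.mem_divisorsAntidiagonal] at hab
      rw [if_neg, mul_zero]
      rintro rfl
      apply hne
      have := hab.1
      simp at this
      simp [this]
    · intro hh
      exact absurd (by simp [hq.ne']) hh
  · intro n hn hnp
    rw [← sum_nthRoots_pow p n hn hnp]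
    have : NeZero n := ⟨hn.ne'⟩
    rw [IsPrimitiveRoot.nthRoots_one_eq_biUnion_primitiveRoots, Finset.sum_biUnion]
    intro a _ b _ hab
    exact IsPrimitiveRoot.disjoint hab

lemma bessel {ι : Type*} (I : Finset ι) (x : ι → ℂ) (N : ℕ)
    (P : Finset ℕ) (hP : P ⊆ Finset.range N) (B : ℝ) (hB0 : 0 ≤ B)
    (hB : ∀ i ∈ I, ∑ j ∈ I, ‖∑ n ∈ Finset.range N, (x i * (starRingEnd ℂ) (x j)) ^ n‖ ≤ B) :
    ∑ i ∈ I, ‖∑ p ∈ P, x i ^ p‖ ^ 2 ≤ B * P.card := by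
  set S : ι → ℂ := fun i => ∑ p ∈ P, x i ^ p with hS
  set V : ℕ → ℂ := fun n => ∑ i ∈ I, (starRingEnd ℂ) (S i) * x i ^ n with hV
  set g : ι → ι → ℂ := fun i j => ∑ n ∈ Finset.range N, (x i * (starRingEnd ℂ) (x j)) ^ n with hg
  set T : ℝ := ∑ i ∈ I, ‖S i‖ ^ 2 with hT
  have hT0 : 0 ≤ T := Finset.sum_nonneg fun i _ => by positivity
  have e1 : (T : ℂ) = ∑ p ∈ P, V p := by
    simp only [hT, hV]
    rw [Finset.sum_comm]
    push_cast
    refine Finset.sum_congr rfl fun i _ => ?_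
    rw [← Finset.mul_sum, ← Complex.conj_mul']
  have e2 : T ^ 2 ≤ P.card * ∑ n ∈ Finset.range N, ‖V n‖ ^ 2 := by
    have h1 : T ≤ ∑ p ∈ P, ‖V p‖ := by
      calc T = ‖(T : ℂ)‖ := by rw [Complex.norm_real, Real.norm_of_nonneg hT0]
        _ ≤ _ := by rw [e1]; exact norm_sum_le _ _
    calc T ^ 2 ≤ (∑ p ∈ P, ‖V p‖) ^ 2 := by gcongr
      _ ≤ P.card * ∑ p ∈ P, ‖V p‖ ^ 2 := sq_sum_le_card_mul_sum_sq
      _ ≤ _ := by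
        gcongr
  have e3 : ((∑ n ∈ Finset.range N, ‖V n‖ ^ 2 : ℝ) : ℂ)
      = ∑ i ∈ I, ∑ j ∈ I, (starRingEnd ℂ) (S i) * S j * g i j := by
    push_cast
    have h0 : ∀ n, (‖V n‖ : ℂ) ^ 2 = ∑ i ∈ I, ∑ j ∈ I, (starRingEnd ℂ) (S i) * x i ^ n *
        (starRingEnd ℂ) ((starRingEnd ℂ) (S j) * x j ^ n) := by
      intro n
      rw [← Complex.mul_conj', hV, map_sum, Finset.sum_mul_sum]
    simp only [h0, hg, Finset.mul_sum]
    rw [Finset.sum_comm]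
    refine Finset.sum_congr rfl fun i _ => ?_
    rw [Finset.sum_comm]
    refine Finset.sum_congr rfl fun j _ => ?_
    refine Finset.sum_congr rfl fun n _ => ?_
    simp only [map_mul, map_pow, Complex.conj_conj, mul_pow]
    ring
  have gs : ∀ i j, ‖g i j‖ = ‖g j i‖ := by
    intro i j
    rw [← Complex.norm_conj (g j i)]
    congr 1
    simp only [hg, map_sum, map_pow, map_mul, Complex.conj_conj]
    refine Finset.sum_congr rfl fun n _ => ?_
    rw [mul_comm]
  have e4 : ∑ n ∈ Finset.range N, ‖V n‖ ^ 2 ≤ B * T := by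
    have h0 : 0 ≤ ∑ n ∈ Finset.range N, ‖V n‖ ^ 2 := Finset.sum_nonneg fun i _ => by positivity
    calc ∑ n ∈ Finset.range N, ‖V n‖ ^ 2
        = ‖((∑ n ∈ Finset.range N, ‖V n‖ ^ 2 : ℝ) : ℂ)‖ := by
          rw [Complex.norm_real, Real.norm_of_nonneg h0]
      _ ≤ ∑ i ∈ I, ∑ j ∈ I, (‖S i‖ ^ 2 / 2 * ‖g i j‖ + ‖S j‖ ^ 2 / 2 * ‖g i j‖) := by
          rw [e3]
          refine (norm_sum_le _ _).trans (Finset.sum_le_sum fun i _ => ?_)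
          refine (norm_sum_le _ _).trans (Finset.sum_le_sum fun j _ => ?_)
          rw [norm_mul, norm_mul, Complex.norm_conj, ← add_mul]
          gcongr
          nlinarith [sq_nonneg (‖S i‖ - ‖S j‖)]
      _ = ∑ i ∈ I, ‖S i‖ ^ 2 * ∑ j ∈ I, ‖g i j‖ := by
          simp only [Finset.sum_add_distrib]
          rw [Finset.sum_comm (f := fun i j => ‖S j‖ ^ 2 / 2 * ‖g i j‖), ← Finset.sum_add_distrib]
          refine Finset.sum_congr rfl fun i _ => ?_
          rw [← Finset.sum_add_distrib, Finset.mul_sum]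
          refine Finset.sum_congr rfl fun j _ => ?_
          rw [gs j i]; ring
      _ ≤ ∑ i ∈ I, ‖S i‖ ^ 2 * B := by
          refine Finset.sum_le_sum fun i hi => ?_
          gcongr
          exact hB i hi
      _ = B * T := by rw [← Finset.sum_mul, mul_comm]
  rcases hT0.eq_or_lt with h | h
  · rw [← h]; positivity
  · have : T * T ≤ (B * P.card) * T := by
      calc T * T = T ^ 2 := by ring
        _ ≤ P.card * (B * T) := e2.trans (by gcongr)
        _ = _ := by ring
    exact le_of_mul_le_mul_right this h

lemma root_sep (m : ℕ) (hm : 0 < m) (ζ : ℂ) (h1 : ζ ^ m = 1) (hne : ζ ≠ 1) :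
    1 / (m : ℝ) ≤ ‖ζ - 1‖ := by
  have hn : ‖ζ‖ = 1 := Complex.norm_eq_one_of_pow_eq_one h1 hm.ne'
  have hs : ∑ k ∈ Finset.range m, ζ ^ k = 0 := by
    rw [geom_sum_eq hne, h1]; simp
  have hb : ∀ k : ℕ, ‖1 - ζ ^ k‖ ≤ k * ‖ζ - 1‖ := by
    intro k
    rw [norm_sub_rev, ← geom_sum_mul ζ k, norm_mul]
    gcongr
    refine (norm_sum_le _ _).trans ?_
    simp [hn]
  have : (m : ℝ) ≤ m * (m * ‖ζ - 1‖) := by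
    calc (m : ℝ) = ‖∑ k ∈ Finset.range m, (1 - ζ ^ k)‖ := by
          rw [Finset.sum_sub_distrib, hs]; simp
      _ ≤ ∑ k ∈ Finset.range m, (m * ‖ζ - 1‖) := by
          refine (norm_sum_le _ _).trans (Finset.sum_le_sum fun k hk => ?_)
          refine (hb k).trans ?_
          gcongr
          exact (Finset.mem_range.mp hk).le
      _ = _ := by simp
  have hm' : (0:ℝ) < m := by exact_mod_cast hm
  rw [div_le_iff₀ hm']
  nlinarith

lemma pow_sub_one_le (z w : ℂ) (hz : ‖z‖ = 1) (hw : ‖w‖ = 1) (k : ℕ) :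
    ‖z ^ k - w ^ k‖ ≤ k * ‖z - w‖ := by
  rw [← geom_sum₂_mul, norm_mul]
  gcongr
  refine (norm_sum_le _ _).trans ?_
  simp [hz, hw]

lemma exclusion (z : ℂ) (hz : ‖z‖ = 1) (hroot : ∀ m : ℕ, 0 < m → z ^ m ≠ 1) (P0 : ℕ) :
    ∀ᶠ Q : ℕ in atTop, ∃ p : ℕ, p.Prime ∧ P0 < p ∧ ∀ q q' : ℕ, Squarefree q → Squarefree q' →
      q ≤ Q → q' ≤ Q → ¬ p ∣ q → ¬ p ∣ q' → ∀ ω ω' : ℂ, ω ^ q = 1 → ω' ^ q' = 1 →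
      1 / (2 * (Q:ℝ) ^ 4) ≤ ‖z * ω - ω'‖ := by
  have hη : 0 < ‖z ^ P0.factorial - 1‖ := by
    rw [norm_pos_iff, sub_ne_zero]; exact hroot _ P0.factorial_pos
  have hev : ∀ᶠ Q : ℕ in atTop, (P0.factorial : ℝ) / ‖z ^ P0.factorial - 1‖ < Q :=
    tendsto_natCast_atTop_atTop.eventually_gt_atTop _
  filter_upwards [hev, eventually_ge_atTop 1] with Q hQ hQ1
  have hQr : (1:ℝ) ≤ Q := by exact_mod_cast hQ1
  by_cases hex : ∃ q q' : ℕ, Squarefree q ∧ Squarefree q' ∧ q ≤ Q ∧ q' ≤ Q ∧ ∃ ω ω' : ℂ,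
      ω ^ q = 1 ∧ ω' ^ q' = 1 ∧ ‖z * ω - ω'‖ < 1 / (2 * (Q:ℝ) ^ 4)
  swap
  · obtain ⟨p, hp, hpp⟩ := Nat.exists_infinite_primes (P0 + 1)
    refine ⟨p, hpp, hp, fun q q' hq hq' hqQ hqQ' _ _ ω ω' h1 h2 => ?_⟩
    by_contra hlt
    exact hex ⟨q, q', hq, hq', hqQ, hqQ', ω, ω', h1, h2, not_le.mp hlt⟩
  -- translate coincidences
  have trans : ∀ q q' : ℕ, Squarefree q → Squarefree q' → ∀ ω ω' : ℂ, ω ^ q = 1 → ω' ^ q' = 1 →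
      ‖z - ω' / ω‖ = ‖z * ω - ω'‖ ∧ (ω' / ω) ^ (q.lcm q') = 1 := by
    intro q q' hq hq' ω ω' h1 h2
    have hn : ‖ω‖ = 1 := Complex.norm_eq_one_of_pow_eq_one h1 hq.ne_zero
    have h0 : ω ≠ 0 := by intro h; simp [h] at hn
    constructor
    · have : z * ω - ω' = (z - ω' / ω) * ω := by field_simp
      rw [this, norm_mul, hn, mul_one]
    · rw [div_pow]
      obtain ⟨a, ha⟩ := Nat.dvd_lcm_left q q'
      obtain ⟨b, hb⟩ := Nat.dvd_lcm_right q q'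
      nth_rewrite 1 [hb]
      rw [ha, pow_mul, pow_mul, h1, h2]; simp
  obtain ⟨q, q', hq, hq', hqQ, hqQ', ω, ω', h1, h2, hlt⟩ := hex
  obtain ⟨t1, t2⟩ := trans q q' hq hq' ω ω' h1 h2
  set ζ := ω' / ω with hζ
  set r := orderOf ζ with hr
  have hlcm : Squarefree (q.lcm q') := by
    rw [Nat.squarefree_iff_prime_squarefree]
    intro x hx hxx
    have h3 : ∀ a : ℕ, Squarefree a → a.factorization x ≤ 1 := fun a ha =>
      (Nat.squarefree_iff_factorization_le_one ha.ne_zero).mp ha x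
    have h4 : (q.lcm q').factorization x ≤ 1 := by
      rw [Nat.factorization_lcm hq.ne_zero hq'.ne_zero]
      simp [h3 q hq, h3 q' hq']
    have h5 := (hx.pow_dvd_iff_le_factorization (k := 2)
      (Nat.lcm_ne_zero hq.ne_zero hq'.ne_zero)).mp (by rwa [pow_two])
    omega
  have hrd : r ∣ q.lcm q' := orderOf_dvd_of_pow_eq_one t2
  have hrs : Squarefree r := hlcm.squarefree_of_dvd hrd
  have hlcmpos : 0 < q.lcm q' := Nat.lcm_pos hq.ne_zero.bot_lt hq'.ne_zero.bot_lt
  have hζn : ‖ζ‖ = 1 := Complex.norm_eq_one_of_pow_eq_one t2 hlcmpos.ne'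
  have hbig : ∃ p, p.Prime ∧ P0 < p ∧ p ∣ r := by
    by_contra hcon
    push Not at hcon
    have hrP : r ∣ P0.factorial := by
      rw [← Nat.prod_primeFactors_of_squarefree hrs]
      refine Finset.prod_primes_dvd _ (fun p hp => (Nat.prime_of_mem_primeFactors hp).prime) ?_
      intro p hp
      have hpp := Nat.prime_of_mem_primeFactors hp
      refine (hpp.dvd_factorial).mpr ?_
      by_contra hh
      exact hcon p hpp (not_le.mp hh) (Nat.dvd_of_mem_primeFactors hp)
    have hζP : ζ ^ P0.factorial = 1 := orderOf_dvd_iff_pow_eq_one.mp hrP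
    have h6 := pow_sub_one_le z ζ hz hζn P0.factorial
    rw [hζP, t1] at h6
    have h7 : ‖z ^ P0.factorial - 1‖ * Q ≤ P0.factorial := by
      have h8 : ‖z * ω - ω'‖ * Q ≤ 1 := by
        calc ‖z * ω - ω'‖ * Q ≤ 1 / (2 * (Q:ℝ) ^ 4) * Q := by gcongr
          _ ≤ 1 := by
            rw [div_mul_eq_mul_div, one_mul, div_le_one (by positivity)]
            nlinarith [pow_le_pow_right₀ hQr (show 1 ≤ 4 by norm_num)]
      calc _ ≤ (P0.factorial * ‖z * ω - ω'‖) * Q := by gcongr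
        _ = P0.factorial * (‖z * ω - ω'‖ * Q) := by ring
        _ ≤ P0.factorial * 1 := by gcongr
        _ = _ := mul_one _
    rw [div_lt_iff₀ hη] at hQ
    linarith
  obtain ⟨p, hp, hpP, hpr⟩ := hbig
  refine ⟨p, hp, hpP, fun a a' ha ha' haQ haQ' hpa hpa' υ υ' g1 g2 => ?_⟩
  by_contra hlt2
  rw [not_le] at hlt2
  obtain ⟨s1, s2⟩ := trans a a' ha ha' υ υ' g1 g2
  have hcl : ∀ b c : ℕ, b ≤ Q → c ≤ Q → 0 < b → 0 < c → b.lcm c ≤ Q ^ 2 := by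
    intro b c hb hc hb0 hc0
    calc b.lcm c ≤ b * c := Nat.le_of_dvd (by positivity) (Nat.lcm_dvd_mul b c)
      _ ≤ Q * Q := Nat.mul_le_mul hb hc
      _ = Q ^ 2 := by ring
  have heq : υ' / υ = ζ := by
    by_contra hne
    have hζ0 : ζ ≠ 0 := by intro h; simp [h] at hζn
    have hpow : ((υ' / υ) / ζ) ^ (a.lcm a' * q.lcm q') = 1 := by
      rw [div_pow, pow_mul, s2, mul_comm, pow_mul, t2]; simp
    have hapos : 0 < a.lcm a' := Nat.lcm_pos ha.ne_zero.bot_lt ha'.ne_zero.bot_lt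
    have h9 := root_sep _ (Nat.mul_pos hapos hlcmpos) _ hpow
      (by rwa [Ne, div_eq_one_iff_eq hζ0])
    have h10 : ‖(υ' / υ) / ζ - 1‖ = ‖υ' / υ - ζ‖ := by
      rw [div_sub_one hζ0, norm_div, hζn, div_one]
    have h11 : ‖υ' / υ - ζ‖ ≤ ‖z - υ' / υ‖ + ‖z - ζ‖ := by
      rw [norm_sub_rev z (υ' / υ)]
      calc ‖υ' / υ - ζ‖ = ‖(υ' / υ - z) + (z - ζ)‖ := by ring_nf
        _ ≤ _ := norm_add_le _ _
    have h12 : ((a.lcm a' * q.lcm q' : ℕ) : ℝ) ≤ (Q:ℝ) ^ 4 := by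
      have := Nat.mul_le_mul (hcl a a' haQ haQ' ha.ne_zero.bot_lt ha'.ne_zero.bot_lt)
        (hcl q q' hqQ hqQ' hq.ne_zero.bot_lt hq'.ne_zero.bot_lt)
      have h' : a.lcm a' * q.lcm q' ≤ Q ^ 4 := this.trans (by ring_nf; rfl)
      exact_mod_cast h'
    have h13 : 1 / (Q:ℝ) ^ 4 ≤ 1 / ((a.lcm a' * q.lcm q' : ℕ) : ℝ) := by
      apply one_div_le_one_div_of_le _ h12
      exact_mod_cast Nat.mul_pos hapos hlcmpos
    have h14 : 1 / (2 * (Q:ℝ) ^ 4) + 1 / (2 * (Q:ℝ) ^ 4) = 1 / (Q:ℝ) ^ 4 := by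
      field_simp; norm_num
    rw [h10] at h9
    rw [s1, t1] at h11
    linarith
  rw [heq] at s2
  have : p ∣ a.lcm a' := hpr.trans (orderOf_dvd_of_pow_eq_one s2)
  have h15 : p ∣ a * a' := this.trans (Nat.lcm_dvd_mul a a')
  rcases hp.dvd_mul.mp h15 with h | h
  · exact hpa h
  · exact hpa' h

lemma sqfree_sum (Q : ℕ) :
    ∑ n ∈ Finset.Icc 1 Q, (1 / n : ℝ) ≤
      2 * ∑ q ∈ (Finset.Icc 1 Q).filter Squarefree, (1 / q : ℝ) := by
  choose a b hab using Nat.sq_mul_squarefree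
  have h2 : ∑ m ∈ Finset.Icc 1 Q, (1 / (m:ℝ) ^ 2) ≤ 2 := by
    have := sum_Ioo_inv_sq_le (α := ℝ) 0 (Q + 1)
    have e : Finset.Ioo 0 (Q + 1) = Finset.Icc 1 Q := by ext; simp; omega
    rw [e] at this
    simpa using this
  calc ∑ n ∈ Finset.Icc 1 Q, (1 / n : ℝ)
      = ∑ n ∈ Finset.Icc 1 Q, (1 / (a n : ℝ) * (1 / (b n : ℝ) ^ 2)) := by
        refine Finset.sum_congr rfl fun n _ => ?_
        have : (n : ℝ) = (b n : ℝ) ^ 2 * a n := by exact_mod_cast (hab n).1.symm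
        rw [this, one_div_mul_one_div, mul_comm]
    _ = ∑ x ∈ (Finset.Icc 1 Q).image (fun n => (a n, b n)),
          (1 / (x.1 : ℝ) * (1 / (x.2 : ℝ) ^ 2)) := by
        rw [Finset.sum_image]
        intro n _ m _ hnm
        simp only [Prod.mk.injEq] at hnm
        rw [← (hab n).1, ← (hab m).1, hnm.1, hnm.2]
    _ ≤ ∑ x ∈ ((Finset.Icc 1 Q).filter Squarefree) ×ˢ (Finset.Icc 1 Q),
          (1 / (x.1 : ℝ) * (1 / (x.2 : ℝ) ^ 2)) := by
        refine Finset.sum_le_sum_of_subset_of_nonneg ?_ (fun _ _ _ => by positivity)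
        intro x hx
        simp only [Finset.mem_image, Finset.mem_Icc] at hx
        obtain ⟨n, hn, rfl⟩ := hx
        obtain ⟨h3, h4⟩ := hab n
        have hb : b n ≠ 0 := by intro h; rw [h] at h3; simp at h3; omega
        have ha : a n ≠ 0 := h4.ne_zero
        have hb1 : b n ≤ n := by
          nlinarith [Nat.pos_of_ne_zero hb, Nat.pos_of_ne_zero ha,
            Nat.mul_le_mul (Nat.pos_of_ne_zero hb) (Nat.pos_of_ne_zero ha),
            Nat.le_mul_of_pos_right (b n ^ 2) (Nat.pos_of_ne_zero ha),
            Nat.le_mul_of_pos_right (b n) (Nat.pos_of_ne_zero hb)]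
        have ha1 : a n ≤ n := by
          calc a n ≤ b n ^ 2 * a n := Nat.le_mul_of_pos_left _ (by positivity)
            _ = n := h3
        simp only [Finset.mem_product, Finset.mem_filter, Finset.mem_Icc]
        exact ⟨⟨⟨Nat.pos_of_ne_zero ha, ha1.trans hn.2⟩, h4⟩, Nat.pos_of_ne_zero hb, hb1.trans hn.2⟩
    _ = (∑ q ∈ (Finset.Icc 1 Q).filter Squarefree, (1 / q : ℝ)) *
          ∑ m ∈ Finset.Icc 1 Q, (1 / (m:ℝ) ^ 2) := by
        rw [Finset.sum_product, Finset.sum_mul_sum]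
    _ ≤ (∑ q ∈ (Finset.Icc 1 Q).filter Squarefree, (1 / q : ℝ)) * 2 := by gcongr
    _ = _ := mul_comm _ _

lemma multiples_sum (Q p : ℕ) (hp : 0 < p) :
    ∑ q ∈ (Finset.Icc 1 Q).filter (fun q => p ∣ q), (1 / q : ℝ) ≤
      1 / p * ∑ n ∈ Finset.Icc 1 Q, (1 / n : ℝ) := by
  calc ∑ q ∈ (Finset.Icc 1 Q).filter (fun q => p ∣ q), (1 / q : ℝ)
      ≤ ∑ q ∈ (Finset.Icc 1 Q).image (fun n => p * n), (1 / q : ℝ) := by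
        refine Finset.sum_le_sum_of_subset_of_nonneg ?_ (fun _ _ _ => by positivity)
        intro q hq
        simp only [Finset.mem_filter, Finset.mem_Icc] at hq
        obtain ⟨⟨h1, h2⟩, c, rfl⟩ := hq
        simp only [Finset.mem_image, Finset.mem_Icc]
        refine ⟨c, ⟨?_, ?_⟩, rfl⟩
        · exact Nat.pos_of_ne_zero (by rintro rfl; simp at h1)
        · exact (Nat.le_mul_of_pos_left c hp).trans h2
    _ = ∑ n ∈ Finset.Icc 1 Q, (1 / (p * n : ℕ) : ℝ) := by
        rw [Finset.sum_image]
        intro a _ b _ h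
        exact Nat.eq_of_mul_eq_mul_left hp h
    _ = _ := by
        rw [Finset.mul_sum]
        refine Finset.sum_congr rfl fun n _ => ?_
        push_cast
        rw [one_div_mul_one_div]

lemma good_sum (Q : ℕ) (D : Finset ℕ) (hD : ∀ p ∈ D, 0 < p) (hs : ∑ p ∈ D, (1 / p : ℝ) ≤ 1 / 4) :
    Real.log Q / 4 ≤
      ∑ q ∈ (Finset.Icc 1 Q).filter (fun q => Squarefree q ∧ ∀ p ∈ D, ¬ p ∣ q), (1 / q : ℝ) := by
  classical
  have hH : Real.log Q ≤ ∑ n ∈ Finset.Icc 1 Q, (1 / n : ℝ) := by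
    have h1 := log_add_one_le_harmonic Q
    rw [harmonic_eq_sum_Icc] at h1
    push_cast at h1
    rcases Nat.eq_zero_or_pos Q with rfl | hQ
    · simp
    · have h2 : Real.log Q ≤ Real.log (Q + 1) := by
        apply Real.log_le_log (by exact_mod_cast hQ); linarith
      simpa using h2.trans h1
  set H := ∑ n ∈ Finset.Icc 1 Q, (1 / n : ℝ) with hHd
  have hH0 : 0 ≤ H := Finset.sum_nonneg fun _ _ => by positivity
  have h3 : ∑ q ∈ (Finset.Icc 1 Q).filter Squarefree, (1 / q : ℝ) ≤
      ∑ q ∈ (Finset.Icc 1 Q).filter (fun q => Squarefree q ∧ ∀ p ∈ D, ¬ p ∣ q), (1 / q : ℝ) +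
      ∑ p ∈ D, ∑ q ∈ (Finset.Icc 1 Q).filter (fun q => p ∣ q), (1 / q : ℝ) := by
    simp only [Finset.sum_filter]
    rw [Finset.sum_comm, ← Finset.sum_add_distrib]
    refine Finset.sum_le_sum fun q _ => ?_
    have hnn : ∀ p ∈ D, (0:ℝ) ≤ if p ∣ q then (1 / q : ℝ) else 0 := fun p _ => by
      split_ifs <;> positivity
    have hsum := Finset.sum_nonneg hnn
    by_cases hq : Squarefree q
    · by_cases h : ∀ p ∈ D, ¬ p ∣ q
      · rw [if_pos hq, if_pos ⟨hq, h⟩]; linarith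
      · rw [if_pos hq, if_neg (fun h' => h h'.2), zero_add]
        push Not at h
        obtain ⟨p, hp, hpq⟩ := h
        have := Finset.single_le_sum hnn hp
        rwa [if_pos hpq] at this
    · rw [if_neg hq, if_neg (fun h' => hq h'.1)]; linarith
  have h4 : ∑ p ∈ D, ∑ q ∈ (Finset.Icc 1 Q).filter (fun q => p ∣ q), (1 / q : ℝ) ≤ 1 / 4 * H := by
    calc _ ≤ ∑ p ∈ D, (1 / p * H : ℝ) :=
          Finset.sum_le_sum fun p hp => multiples_sum Q p (hD p hp)
      _ = (∑ p ∈ D, (1 / p : ℝ)) * H := by rw [Finset.sum_mul]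
      _ ≤ _ := by gcongr
  have h5 := sqfree_sum Q
  linarith

lemma geom_bound (x y : ℂ) (hx : ‖x‖ = 1) (hy : ‖y‖ = 1) (δ : ℝ) (hδ : 0 < δ) (h : δ ≤ ‖x - y‖)
    (N : ℕ) : ‖∑ n ∈ Finset.range N, (x * (starRingEnd ℂ) y) ^ n‖ ≤ 2 / δ := by
  set w := x * (starRingEnd ℂ) y with hw
  have hwn : ‖w‖ = 1 := by rw [hw, norm_mul, Complex.norm_conj, hx, hy, mul_one]
  have hyy : y * (starRingEnd ℂ) y = 1 := by rw [Complex.mul_conj', hy]; simp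
  have h1 : ‖w - 1‖ = ‖x - y‖ := by
    rw [hw, ← hyy, ← sub_mul, norm_mul, Complex.norm_conj, hy, mul_one]
  have hpos : 0 < ‖w - 1‖ := by rw [h1]; linarith
  have hne : w ≠ 1 := by rwa [norm_pos_iff, sub_ne_zero] at hpos
  rw [geom_sum_eq hne, norm_div]
  have h2 : ‖w ^ N - 1‖ ≤ 2 := by
    refine (norm_sub_le _ _).trans ?_
    rw [norm_pow, hwn]; norm_num
  rw [h1]
  gcongr

lemma expand (P : Finset ℕ) (q : ℕ) (hq : Squarefree q) (hP : ∀ p ∈ P, q.Coprime p) (z : ℂ) :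
    ‖∑ p ∈ P, z ^ p‖ ^ 2 * (1 / q : ℝ) ≤
      ∑ ω ∈ primitiveRoots q ℂ, ‖∑ p ∈ P, (z * ω) ^ p‖ ^ 2 := by
  have hq0 : 0 < q := hq.ne_zero.bot_lt
  have e : ∑ ω ∈ primitiveRoots q ℂ, ∑ p ∈ P, (z * ω) ^ p
      = (ArithmeticFunction.moebius q : ℂ) * ∑ p ∈ P, z ^ p := by
    rw [Finset.sum_comm, Finset.mul_sum]
    refine Finset.sum_congr rfl fun p hp => ?_
    simp only [mul_pow]
    rw [← Finset.mul_sum, ramanujan_sum p q hq0 (hP p hp), mul_comm]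
  have hm : ‖(ArithmeticFunction.moebius q : ℂ)‖ = 1 := by
    rcases (ArithmeticFunction.moebius_ne_zero_iff_eq_or.mp
      (ArithmeticFunction.moebius_ne_zero_iff_squarefree.mpr hq)) with h | h <;> simp [h]
  have h1 : ‖∑ p ∈ P, z ^ p‖ ≤ ∑ ω ∈ primitiveRoots q ℂ, ‖∑ p ∈ P, (z * ω) ^ p‖ := by
    calc ‖∑ p ∈ P, z ^ p‖ = ‖∑ ω ∈ primitiveRoots q ℂ, ∑ p ∈ P, (z * ω) ^ p‖ := by
          rw [e, norm_mul, hm, one_mul]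
      _ ≤ _ := norm_sum_le _ _
  have h2 : ((primitiveRoots q ℂ).card : ℝ) ≤ q := by
    rw [Complex.card_primitiveRoots]
    exact_mod_cast Nat.totient_le q
  have hqr : (0:ℝ) < q := by exact_mod_cast hq0
  rw [mul_one_div, div_le_iff₀ hqr, mul_comm]
  calc ‖∑ p ∈ P, z ^ p‖ ^ 2 ≤ (∑ ω ∈ primitiveRoots q ℂ, ‖∑ p ∈ P, (z * ω) ^ p‖) ^ 2 := by gcongr
    _ ≤ _ := sq_sum_le_card_mul_sum_sq
    _ ≤ _ := by gcongr

/-- primes in `(Q, Q^7]` -/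
def PP (Q : ℕ) : Finset ℕ := (Finset.range (Q ^ 7 + 1)).filter (fun p => p.Prime ∧ Q < p)

lemma finite_bound (J : ℕ) (z : Fin J → ℂ) (hz : ∀ j, ‖z j‖ = 1)
    (hd : ∀ i j, i ≠ j → ∀ m : ℕ, 0 < m → z i ^ m ≠ z j ^ m) :
    ∀ᶠ Q : ℕ in atTop, (∑ j, ‖∑ p ∈ PP Q, z j ^ p‖ ^ 2) * (Real.log Q / 4) ≤
      2 * (Q:ℝ) ^ 7 * (PP Q).card := by
  classical
  have hz0 : ∀ j, z j ≠ 0 := fun j h => by have := hz j; simp [h] at this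
  have hex : ∀ᶠ Q : ℕ in atTop, ∀ i j : Fin J, i ≠ j → ∃ p : ℕ, p.Prime ∧ 4 * J ^ 2 < p ∧
      ∀ q q' : ℕ, Squarefree q → Squarefree q' →
      q ≤ Q → q' ≤ Q → ¬ p ∣ q → ¬ p ∣ q' → ∀ ω ω' : ℂ, ω ^ q = 1 → ω' ^ q' = 1 →
      1 / (2 * (Q:ℝ) ^ 4) ≤ ‖z i / z j * ω - ω'‖ := by
    rw [eventually_all]; intro i
    rw [eventually_all]; intro j
    by_cases hij : i = j
    · simp [hij]
    · filter_upwards [exclusion (z i / z j) (by rw [norm_div, hz, hz, div_one]) (by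
        intro m hm h
        rw [div_pow, div_eq_one_iff_eq (pow_ne_zero _ (hz0 j))] at h
        exact hd i j hij m hm h) (4 * J ^ 2)] with Q hQ _
      exact hQ
  filter_upwards [hex, eventually_ge_atTop (4 * J + 1)] with Q hQ hQJ
  have hQ1 : 1 ≤ Q := by omega
  have hQr : (1:ℝ) ≤ Q := by exact_mod_cast hQ1
  choose! pr hpr1 hpr2 hpr3 using hQ
  set D : Finset ℕ := (Finset.univ : Finset (Fin J)).offDiag.image (fun x => pr x.1 x.2) with hD
  have hDp : ∀ p ∈ D, 0 < p ∧ 4 * J ^ 2 < p := by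
    intro p hp
    simp only [hD, Finset.mem_image, Finset.mem_offDiag] at hp
    obtain ⟨x, hx, rfl⟩ := hp
    exact ⟨(hpr1 _ _ hx.2.2).pos, hpr2 _ _ hx.2.2⟩
  have hDc : D.card ≤ J ^ 2 := by
    refine Finset.card_image_le.trans ?_
    rw [Finset.offDiag_card, Finset.card_univ, Fintype.card_fin, pow_two]
    omega
  have hDs : ∑ p ∈ D, (1 / p : ℝ) ≤ 1 / 4 := by
    calc ∑ p ∈ D, (1 / p : ℝ) ≤ ∑ p ∈ D, (1 / (4 * (J:ℝ) ^ 2 + 1)) := by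
          refine Finset.sum_le_sum fun p hp => ?_
          apply one_div_le_one_div_of_le (by positivity)
          exact_mod_cast (hDp p hp).2
      _ = D.card * (1 / (4 * (J:ℝ) ^ 2 + 1)) := by simp
      _ ≤ (J:ℝ) ^ 2 * (1 / (4 * (J:ℝ) ^ 2 + 1)) := by
          gcongr
          exact_mod_cast hDc
      _ ≤ 1 / 4 := by
          rw [mul_one_div, div_le_div_iff₀ (by positivity) (by norm_num)]
          linarith
  have hG := good_sum Q D (fun p hp => (hDp p hp).1) hDs
  set QQ := (Finset.Icc 1 Q).filter (fun q => Squarefree q ∧ ∀ p ∈ D, ¬ p ∣ q) with hQQ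
  set Ω : Finset (Σ _ : ℕ, ℂ) := QQ.sigma (fun q => primitiveRoots q ℂ) with hΩ
  set I : Finset (Fin J × (Σ _ : ℕ, ℂ)) := Finset.univ ×ˢ Ω with hI
  have hIc : (I.card : ℝ) ≤ J * (Q:ℝ) ^ 2 := by
    have h1 : Ω.card ≤ Q ^ 2 := by
      rw [hΩ, Finset.card_sigma]
      calc ∑ q ∈ QQ, (primitiveRoots q ℂ).card ≤ ∑ q ∈ QQ, Q := by
            refine Finset.sum_le_sum fun q hq => ?_
            rw [Complex.card_primitiveRoots]
            simp only [hQQ, Finset.mem_filter, Finset.mem_Icc] at hq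
            exact (Nat.totient_le q).trans hq.1.2
        _ = QQ.card * Q := by simp
        _ ≤ Q * Q := by
            gcongr
            refine (Finset.card_filter_le _ _).trans ?_
            simp
        _ = _ := by ring
    have h2 : I.card ≤ J * Q ^ 2 := by
      rw [hI, Finset.card_product]
      simp only [Finset.card_univ, Fintype.card_fin]
      gcongr
    exact_mod_cast h2
  set x : Fin J × (Σ _ : ℕ, ℂ) → ℂ := fun i => z i.1 * i.2.2 with hx
  have hmem : ∀ i ∈ I, Squarefree i.2.1 ∧ i.2.1 ≤ Q ∧ (∀ p ∈ D, ¬ p ∣ i.2.1) ∧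
      IsPrimitiveRoot i.2.2 i.2.1 := by
    intro i hi
    simp only [hI, hΩ, hQQ, Finset.mem_product, Finset.mem_univ, true_and, Finset.mem_sigma,
      Finset.mem_filter, Finset.mem_Icc] at hi
    exact ⟨hi.1.2.1, hi.1.1.2, hi.1.2.2, isPrimitiveRoot_of_mem_primitiveRoots hi.2⟩
  have hx1 : ∀ i ∈ I, ‖x i‖ = 1 := by
    intro i hi
    obtain ⟨h1, h2, h3, h4⟩ := hmem i hi
    rw [hx]
    simp only [norm_mul, hz, one_mul]
    exact Complex.norm_eq_one_of_pow_eq_one h4.pow_eq_one h1.ne_zero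
  have hsep : ∀ i ∈ I, ∀ j ∈ I, i ≠ j → 1 / (2 * (Q:ℝ) ^ 4) ≤ ‖x i - x j‖ := by
    rintro ⟨i, q, ω⟩ hi ⟨j, q', ω'⟩ hj hne
    obtain ⟨h1, h2, h3, h4⟩ := hmem _ hi
    obtain ⟨g1, g2, g3, g4⟩ := hmem _ hj
    simp only at h1 h2 h3 h4 g1 g2 g3 g4
    simp only [hx]
    by_cases hij : i = j
    · subst hij
      have hωne : ω ≠ ω' := by
        rintro rfl
        have := h4.unique g4
        subst this
        exact hne rfl
      have hω' : ‖ω'‖ = 1 := Complex.norm_eq_one_of_pow_eq_one g4.pow_eq_one g1.ne_zero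
      have hω0 : ω' ≠ 0 := by intro h; simp [h] at hω'
      have hp : (ω / ω') ^ (q * q') = 1 := by
        rw [div_pow, pow_mul, h4.pow_eq_one, mul_comm, pow_mul, g4.pow_eq_one]; simp
      have hpos : 0 < q * q' := Nat.mul_pos h1.ne_zero.bot_lt g1.ne_zero.bot_lt
      have hs := root_sep (q * q') hpos _ hp (by rwa [Ne, div_eq_one_iff_eq hω0])
      rw [div_sub_one hω0, norm_div, hω', div_one] at hs
      rw [← mul_sub, norm_mul, hz, one_mul]
      refine le_trans ?_ hs
      apply one_div_le_one_div_of_le (by exact_mod_cast hpos)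
      push_cast
      calc (q:ℝ) * q' ≤ Q * Q := by gcongr
        _ = (Q:ℝ) ^ 2 := by ring
        _ ≤ (Q:ℝ) ^ 4 := pow_le_pow_right₀ hQr (by norm_num)
        _ ≤ _ := by linarith [pow_pos (zero_lt_one.trans_le hQr) 4]
    · have hpD : pr i j ∈ D := by
        rw [hD, Finset.mem_image]
        exact ⟨(i, j), by simp [hij], rfl⟩
      have := hpr3 i j hij q q' h1 g1 h2 g2 (h3 _ hpD) (g3 _ hpD) ω ω' h4.pow_eq_one g4.pow_eq_one
      have e : z i * ω - z j * ω' = z j * (z i / z j * ω - ω') := by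
        have := hz0 j
        field_simp
      rw [e, norm_mul, hz, one_mul]
      exact this
  have hB : ∀ i ∈ I, ∑ j ∈ I,
      ‖∑ n ∈ Finset.range (Q ^ 7 + 1), (x i * (starRingEnd ℂ) (x j)) ^ n‖ ≤ 2 * (Q:ℝ) ^ 7 := by
    intro i hi
    rw [← Finset.add_sum_erase _ _ hi]
    have h1 : ‖∑ n ∈ Finset.range (Q ^ 7 + 1), (x i * (starRingEnd ℂ) (x i)) ^ n‖ ≤ (Q:ℝ) ^ 7 + 1 := by
      refine (norm_sum_le _ _).trans ?_
      simp [hx1 i hi]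
    have h2 : ∑ j ∈ I.erase i, ‖∑ n ∈ Finset.range (Q ^ 7 + 1), (x i * (starRingEnd ℂ) (x j)) ^ n‖
        ≤ J * (Q:ℝ) ^ 2 * (4 * (Q:ℝ) ^ 4) := by
      calc _ ≤ ∑ j ∈ I.erase i, (4 * (Q:ℝ) ^ 4) := by
            refine Finset.sum_le_sum fun j hj => ?_
            rw [Finset.mem_erase] at hj
            refine (geom_bound _ _ (hx1 i hi) (hx1 j hj.2) _ (by positivity)
              (hsep i hi j hj.2 hj.1.symm) _).trans (le_of_eq ?_)
            field_simp; norm_num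
        _ = (I.erase i).card * (4 * (Q:ℝ) ^ 4) := by simp
        _ ≤ I.card * (4 * (Q:ℝ) ^ 4) := by
            gcongr
            exact Finset.erase_subset _ _
        _ ≤ _ := by gcongr
    have h3 : (4 * J + 1 : ℝ) * (Q:ℝ) ^ 6 ≤ Q * (Q:ℝ) ^ 6 := by
      gcongr
      exact_mod_cast hQJ
    have h4 : (1:ℝ) ≤ (Q:ℝ) ^ 6 := one_le_pow₀ hQr
    nlinarith
  have hbes := bessel I x (Q ^ 7 + 1) (PP Q) (Finset.filter_subset _ _) (2 * (Q:ℝ) ^ 7)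
    (by positivity) hB
  refine le_trans ?_ hbes
  rw [hI, Finset.sum_product, Finset.sum_mul]
  refine Finset.sum_le_sum fun j _ => ?_
  rw [hΩ, Finset.sum_sigma]
  calc ‖∑ p ∈ PP Q, z j ^ p‖ ^ 2 * (Real.log Q / 4)
      ≤ ‖∑ p ∈ PP Q, z j ^ p‖ ^ 2 * ∑ q ∈ QQ, (1 / q : ℝ) := by gcongr
    _ = ∑ q ∈ QQ, ‖∑ p ∈ PP Q, z j ^ p‖ ^ 2 * (1 / q : ℝ) := by rw [Finset.mul_sum]
    _ ≤ _ := by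
      refine Finset.sum_le_sum fun q hq => ?_
      simp only [hQQ, Finset.mem_filter, Finset.mem_Icc] at hq
      refine expand (PP Q) q hq.2.1 ?_ (z j)
      intro p hp
      simp only [PP, Finset.mem_filter] at hp
      exact ((Nat.Prime.coprime_iff_not_dvd hp.2.1).mpr fun h => by
        have := Nat.le_of_dvd hq.1.1 h; omega).symm

lemma PP_card (Q : ℕ) (hQ : 4 ≤ Q) : (Q:ℝ) ^ 7 ≤ 28 * ((PP Q).card * Real.log Q) := by
  have hQr : (4:ℝ) ≤ Q := by exact_mod_cast hQ
  have h1 := Chebyshev.pi_ge (Q ^ 7)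
  have hlogpos : 0 < Real.log Q := Real.log_pos (by linarith)
  have hl : Real.log ((Q ^ 7 : ℕ) : ℝ) = 7 * Real.log Q := by
    push_cast; rw [Real.log_pow]; norm_num
  rw [hl, div_le_iff₀ (by positivity)] at h1
  push_cast at h1
  have h2 : (Nat.primeCounting (Q ^ 7) : ℝ) ≤ (PP Q).card + (Q + 1) := by
    have : Nat.primeCounting (Q ^ 7) ≤ (PP Q).card + (Q + 1) := by
      rw [Nat.primeCounting, Nat.primeCounting', Nat.count_eq_card_filter_range]
      calc _ ≤ (PP Q ∪ Finset.range (Q + 1)).card := by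
            apply Finset.card_le_card
            intro p hp
            simp only [PP, Finset.mem_union, Finset.mem_filter, Finset.mem_range] at *
            by_cases h : Q < p
            · exact Or.inl ⟨hp.1, hp.2, h⟩
            · right; omega
        _ ≤ _ := (Finset.card_union_le _ _).trans (by simp)
    exact_mod_cast this
  have h3 : Real.log Q ≤ Q := (Real.log_le_sub_one_of_pos (by linarith)).trans (by linarith)
  have h4 : Real.log ((Q:ℝ) ^ 7 + 1) ≤ 8 * Q := by
    calc Real.log ((Q:ℝ) ^ 7 + 1) ≤ Real.log ((Q:ℝ) ^ 8) := by
          apply Real.log_le_log (by positivity)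
          have : (1:ℝ) ≤ (Q:ℝ) ^ 7 := one_le_pow₀ (by linarith)
          calc (Q:ℝ) ^ 7 + 1 ≤ 4 * (Q:ℝ) ^ 7 := by linarith
            _ ≤ Q * (Q:ℝ) ^ 7 := by gcongr
            _ = _ := by ring
      _ = 8 * Real.log Q := by rw [Real.log_pow]; norm_num
      _ ≤ _ := by linarith
  have h5 := Real.log_two_gt_d9
  have h6 : (Q + 1 : ℝ) * (7 * Real.log Q) ≤ (Q + 1) * (7 * Q) := by gcongr
  have h7 : (1024:ℝ) * (Q:ℝ) ^ 2 ≤ (Q:ℝ) ^ 7 := by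
    have : (4:ℝ) ^ 5 ≤ (Q:ℝ) ^ 5 := by gcongr
    calc (1024:ℝ) * (Q:ℝ) ^ 2 = 4 ^ 5 * (Q:ℝ) ^ 2 := by norm_num
      _ ≤ (Q:ℝ) ^ 5 * (Q:ℝ) ^ 2 := by gcongr
      _ = _ := by ring
  have h8 : (Nat.primeCounting (Q ^ 7) : ℝ) * (7 * Real.log Q) ≤
      ((PP Q).card + (Q + 1)) * (7 * Real.log Q) := by gcongr
  have h9 : (Q:ℝ) ≤ (Q:ℝ) ^ 2 := by nlinarith
  have h10 : (Q:ℝ) ^ 7 * 0.69 ≤ (Q:ℝ) ^ 7 * Real.log 2 := by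
    gcongr; linarith
  nlinarith


lemma large_of_close (P : Finset ℕ) (z : ℂ)
    (h : (∑ p ∈ P, ‖z ^ p - 1‖ ^ 2) / P.card ≤ 1 / 4) :
    (P.card : ℝ) ^ 2 / 4 ≤ ‖∑ p ∈ P, z ^ p‖ ^ 2 := by
  rcases P.card.eq_zero_or_pos with h0 | h0
  · rw [h0]; norm_num
  have hc : (0:ℝ) < P.card := by exact_mod_cast h0
  rw [div_le_iff₀ hc] at h
  have h1 : ‖∑ p ∈ P, z ^ p - P.card‖ ^ 2 ≤ (P.card / 2 : ℝ) ^ 2 := by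
    have e : ∑ p ∈ P, z ^ p - P.card = ∑ p ∈ P, (z ^ p - 1) := by
      rw [Finset.sum_sub_distrib]; simp
    calc ‖∑ p ∈ P, z ^ p - P.card‖ ^ 2 ≤ (∑ p ∈ P, ‖z ^ p - 1‖) ^ 2 := by
          rw [e]; gcongr; exact norm_sum_le _ _
      _ ≤ P.card * ∑ p ∈ P, ‖z ^ p - 1‖ ^ 2 := sq_sum_le_card_mul_sum_sq
      _ ≤ P.card * (1 / 4 * P.card) := by gcongr
      _ = _ := by ring
  have h2 : ‖∑ p ∈ P, z ^ p - P.card‖ ≤ P.card / 2 := by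
    exact (pow_le_pow_iff_left₀ (norm_nonneg _) (by positivity) two_ne_zero).mp h1
  have h3 : (P.card : ℝ) / 2 ≤ ‖∑ p ∈ P, z ^ p‖ := by
    have h4 : ‖(P.card : ℂ)‖ ≤ ‖∑ p ∈ P, z ^ p‖ + ‖∑ p ∈ P, z ^ p - P.card‖ := by
      calc ‖(P.card : ℂ)‖ = ‖∑ p ∈ P, z ^ p - (∑ p ∈ P, z ^ p - P.card)‖ := by
            congr 1; ring
        _ ≤ _ := norm_sub_le _ _
    rw [Complex.norm_natCast] at h4
    linarith
  calc (P.card : ℝ) ^ 2 / 4 = (P.card / 2 : ℝ) ^ 2 := by ring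
    _ ≤ _ := by gcongr

/-- Example 3.12: the sequence of prime numbers is not a rigidity sequence: there is no
continuous (atomless) probability measure `σ` on the unit circle with
`∫ z^{n_k} dσ(z) → 1`, where `(n_k)` is the strictly increasing enumeration of the
primes. -/
theorem primes_not_rigidity_sequence
    (n : ℕ → ℕ) (hmono : StrictMono n) (hprime : ∀ k, (n k).Prime)
    (hall : ∀ p : ℕ, p.Prime → ∃ k, n k = p) :
    ¬ ∃ σ : Measure ℂ, IsProbabilityMeasure σ ∧ σ {z : ℂ | ‖z‖ = 1}ᶜ = 0 ∧
      (∀ z : ℂ, σ {z} = 0) ∧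
      Tendsto (fun k => ∫ z : ℂ, z ^ (n k) ∂σ) atTop (𝓝 1) := by
  rintro ⟨σ, hσ, hcirc, hatom, hlim⟩
  have hna : NullSingletonClass σ := ⟨hatom⟩
  have hae : ∀ᵐ z ∂σ, ‖z‖ = 1 := by rw [ae_iff]; exact hcirc
  have hint : ∀ p : ℕ, Integrable (fun z : ℂ => z ^ p) σ := by
    intro p
    refine Integrable.of_bound (by fun_prop) 1 ?_
    filter_upwards [hae] with z hz
    simp [hz]
  set a : ℕ → ℝ := fun p => ∫ z, ‖z ^ p - 1‖ ^ 2 ∂σ with ha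
  have hint2 : ∀ p : ℕ, Integrable (fun z : ℂ => ‖z ^ p - 1‖ ^ 2) σ := by
    intro p
    refine Integrable.of_bound (by fun_prop) 4 ?_
    filter_upwards [hae] with z hz
    have : ‖z ^ p - 1‖ ≤ 2 := by
      refine (norm_sub_le _ _).trans ?_
      rw [norm_pow, hz]; norm_num
    rw [Real.norm_of_nonneg (by positivity)]
    nlinarith [norm_nonneg (z ^ p - 1)]
  have haeq : ∀ p, a p = 2 - 2 * (∫ z, z ^ p ∂σ).re := by
    intro p
    have h1 : a p = ∫ z : ℂ, (2 - 2 * (z ^ p).re) ∂σ := by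
      apply integral_congr_ae
      filter_upwards [hae] with z hz
      have h2 : ‖z ^ p‖ ^ 2 = 1 := by rw [norm_pow, hz]; norm_num
      rw [← Complex.normSq_eq_norm_sq] at h2 ⊢
      rw [Complex.normSq_sub, h2]
      simp; ring
    have h3 : Integrable (fun z : ℂ => (z ^ p).re) σ := (hint p).re
    rw [h1, integral_sub (integrable_const _) (h3.const_mul 2), integral_const_mul]
    have h4 : ∫ z : ℂ, (z ^ p).re ∂σ = (∫ z, z ^ p ∂σ).re := integral_re (hint p)
    rw [h4]; simp
  have halim : Tendsto (fun k => a (n k)) atTop (𝓝 0) := by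
    simp only [haeq]
    have h1 : Tendsto (fun k => (∫ z : ℂ, z ^ (n k) ∂σ).re) atTop (𝓝 1) := by
      simpa [Function.comp_def] using (Complex.continuous_re.tendsto 1).comp hlim
    have h2 := (h1.const_mul 2).const_sub 2
    simpa using h2
  set F : ℕ → ℂ → ℝ := fun Q z => (∑ p ∈ PP Q, ‖z ^ p - 1‖ ^ 2) / (PP Q).card with hF
  have hF0 : ∀ Q z, 0 ≤ F Q z := fun Q z => by
    simp only [hF]
    exact div_nonneg (Finset.sum_nonneg fun _ _ => by positivity) (by positivity)
  have hFint : ∀ Q, Integrable (F Q) σ := by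
    intro Q
    exact (integrable_finsetSum _ fun p _ => hint2 p).div_const _
  have hFeq : ∀ Q, ∫ z, F Q z ∂σ = (∑ p ∈ PP Q, a p) / (PP Q).card := by
    intro Q
    simp only [hF, ha]
    rw [integral_div, integral_finsetSum _ fun p _ => hint2 p]
  have hFlim : Tendsto (fun Q => ∫ z, F Q z ∂σ) atTop (𝓝 0) := by
    rw [Metric.tendsto_atTop] at halim ⊢
    intro ε hε
    obtain ⟨k0, hk0⟩ := halim (ε / 2) (by positivity)
    refine ⟨n k0, fun Q hQ => ?_⟩
    have h0 : 0 ≤ ∫ z, F Q z ∂σ := integral_nonneg (hF0 Q)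
    rw [Real.dist_eq, sub_zero, abs_of_nonneg h0, hFeq]
    refine lt_of_le_of_lt ?_ (half_lt_self hε)
    apply div_le_of_le_mul₀ (by positivity) (by positivity)
    calc ∑ p ∈ PP Q, a p ≤ ∑ p ∈ PP Q, ε / 2 := by
          refine Finset.sum_le_sum fun p hp => ?_
          simp only [PP, Finset.mem_filter] at hp
          obtain ⟨k, rfl⟩ := hall p hp.2.1
          have hk : k0 ≤ k := by
            have : n k0 < n k := lt_of_le_of_lt hQ hp.2.2
            exact (hmono.lt_iff_lt.mp this).le
          have := hk0 k hk
          rw [Real.dist_eq, sub_zero] at this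
          exact (le_abs_self _).trans this.le
      _ = _ := by simp [mul_comm]
  have hmeas : TendstoInMeasure σ F atTop (fun _ => (0:ℝ)) := by
    refine tendstoInMeasure_of_tendsto_eLpNorm (p := 1) one_ne_zero
      (fun Q => (hFint Q).aestronglyMeasurable) aestronglyMeasurable_const ?_
    have e : ∀ Q, eLpNorm (F Q - fun _ => (0:ℝ)) 1 σ = ENNReal.ofReal (∫ z, F Q z ∂σ) := by
      intro Q
      have e1 : (F Q - fun _ => (0:ℝ)) = F Q := by ext; simp
      rw [e1, eLpNorm_one_eq_lintegral_enorm, ← ofReal_integral_norm_eq_lintegral_enorm (hFint Q)]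
      congr 2
      ext z
      exact Real.norm_of_nonneg (hF0 Q z)
    simp only [e]
    simpa using ENNReal.tendsto_ofReal hFlim
  obtain ⟨ns, hns, hconv⟩ := hmeas.exists_seq_tendsto_ae
  -- choose points
  obtain ⟨f, hf1, hf2⟩ := exists_seq_of_forall_finset_exists
    (fun z : ℂ => ‖z‖ = 1 ∧ Tendsto (fun i => F (ns i) z) atTop (𝓝 0))
    (fun z w : ℂ => ∀ m : ℕ, 0 < m → w ^ m ≠ z ^ m) (by
      intro s _
      have hcount : (⋃ w ∈ s, ⋃ m : ℕ, {z : ℂ | 0 < m ∧ z ^ m = w ^ m}).Countable := by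
        refine s.countable_toSet.biUnion fun w _ => Set.countable_iUnion fun m => ?_
        by_cases hm : 0 < m
        · refine Set.Finite.countable ?_
          refine (Polynomial.nthRoots m (w ^ m)).toFinset.finite_toSet.subset ?_
          intro z hz
          simp only [Finset.mem_coe, Multiset.mem_toFinset]
          exact (Polynomial.mem_nthRoots hm).mpr hz.2
        · simp [hm]
      have hnull := hcount.ae_notMem σ
      obtain ⟨z, hz⟩ := (hae.and (hconv.and hnull)).exists
      refine ⟨z, ⟨hz.1, hz.2.1⟩, fun w hw m hm h => hz.2.2 ?_⟩
      simp only [Set.mem_iUnion]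
      exact ⟨w, hw, m, hm, h⟩)
  obtain ⟨J, hJ⟩ : ∃ J : ℕ, (J : ℝ) = 1000 := ⟨1000, by norm_num⟩
  have hd : ∀ i j : Fin J, i ≠ j → ∀ m : ℕ, 0 < m → f i ^ m ≠ f j ^ m := by
    intro i j hij m hm
    rcases lt_or_gt_of_ne hij with h | h
    · exact (hf2 i j h m hm).symm
    · exact hf2 j i h m hm
  have hfin := hns.tendsto_atTop.eventually
    (finite_bound J (fun j => f j) (fun j => (hf1 j).1) hd)
  have hclose : ∀ᶠ i in atTop, ∀ j : Fin J, F (ns i) (f j) ≤ 1 / 4 := by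
    rw [eventually_all]
    intro j
    exact ((hf1 j).2.eventually_lt_const (by norm_num : (0:ℝ) < 1 / 4)).mono fun _ h => h.le
  obtain ⟨i, h1, h2, h3⟩ := (hfin.and (hclose.and
    (hns.tendsto_atTop.eventually (eventually_ge_atTop 4)))).exists
  set Q := ns i with hQ
  have hQr : (4:ℝ) ≤ Q := by exact_mod_cast h3
  have h4 := PP_card Q h3
  have hlog : 0 < Real.log Q := Real.log_pos (by linarith)
  have h5 : (1000:ℝ) * (((PP Q).card : ℝ) ^ 2 / 4) ≤
      ∑ j : Fin J, ‖∑ p ∈ PP Q, f j ^ p‖ ^ 2 := by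
    calc (1000:ℝ) * (((PP Q).card : ℝ) ^ 2 / 4)
        = ∑ j : Fin J, ((PP Q).card : ℝ) ^ 2 / 4 := by
          rw [Finset.sum_const, Finset.card_univ, Fintype.card_fin, nsmul_eq_mul, hJ]
      _ ≤ _ := Finset.sum_le_sum fun j _ => large_of_close _ _ (h2 j)
  have h6 := mul_le_mul_of_nonneg_right h5 (by positivity : 0 ≤ Real.log Q / 4)
  have h7 := h6.trans h1
  have hQ7 : (0:ℝ) < (Q:ℝ) ^ 7 := by positivity
  have hcpos : (0:ℝ) < (PP Q).card := by
    by_contra hcon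
    have h0 : ((PP Q).card : ℝ) = 0 := le_antisymm (not_lt.mp hcon) (by positivity)
    rw [h0] at h4
    linarith
  have h8 : (1000 / 16 * ((PP Q).card * Real.log Q)) * (PP Q).card ≤
      (2 * (Q:ℝ) ^ 7) * (PP Q).card := by
    calc _ = (1000:ℝ) * (((PP Q).card : ℝ) ^ 2 / 4) * (Real.log Q / 4) := by ring
      _ ≤ _ := h7
  have h9 := le_of_mul_le_mul_right h8 hcpos
  linarith
end
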